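/- arXiv:1111.1029 — 3 statements merged into one kernel-verified Lean document; each statement's English description precedes it below -/
import Mathlib

section
/- Let k₁, k₂, k₃, k₄ > 0 and let f : ℝ → ℝ be a C^∞ function with f(z) = 0 if and only if z = 0. Then the closed-loop stabilization subsystem ż = −ū r, ψ̇ = r, ū̇ = k₁ z r − k₂ ū, ṙ = −k₃ ψ − k₄ r + f(z) cos t is globally uniformly asymptotically stable (GUAS): there exists a class-κℓ function χ such that for every t₀ ∈ ℝ, every solution (z, ψ, ū, r) : [t₀, ∞) → ℝ⁴ of the system satisfies ‖(z(t), ψ(t), ū(t), r(t))‖ ≤ χ(‖(z(t₀), ψ(t₀), ū(t₀), r(t₀))‖, t − t₀) for all t ≥ t₀, where ‖·‖ is the Euclidean norm on ℝ⁴. -/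
open Real Filter

/-- Euclidean norm on ℝ⁴. -/
noncomputable def norm4 (a b c d : ℝ) : ℝ := Real.sqrt (a ^ 2 + b ^ 2 + c ^ 2 + d ^ 2)

/-- A class-κ function: continuous, strictly increasing on [0,∞), vanishing at 0. -/
def IsClassK (ρ : ℝ → ℝ) : Prop :=
  ContinuousOn ρ (Set.Ici 0) ∧ StrictMonoOn ρ (Set.Ici 0) ∧ ρ 0 = 0

/-- A class-κℓ function. -/
def IsClassKL (χ : ℝ → ℝ → ℝ) : Prop :=
  (∀ s, 0 ≤ s → IsClassK fun r => χ r s) ∧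
  (∀ r, 0 ≤ r → AntitoneOn (fun s => χ r s) (Set.Ici 0)) ∧
  (∀ r, 0 ≤ r → Tendsto (fun s => χ r s) atTop (nhds 0))

open Set in
/-- Construction of a class-KL bound out of uniform stability and uniform attractivity. -/
theorem kl_aux (P : ℝ → ℝ → ℝ → Prop)
    (hρ : ∀ ρ s y, P ρ s y → 0 ≤ ρ)
    (hB : ∀ R, 0 ≤ R → ∃ M, ∀ ρ s y, P ρ s y → ρ ≤ R → y ≤ M)
    (hS : ∀ ε, 0 < ε → ∃ δ, 0 < δ ∧ ∀ ρ s y, P ρ s y → ρ ≤ δ → y ≤ ε)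
    (hA : ∀ R ε, 0 ≤ R → 0 < ε → ∃ T, ∀ ρ s y, P ρ s y → ρ ≤ R → T ≤ s → y ≤ ε) :
    ∃ χ : ℝ → ℝ → ℝ, IsClassKL χ ∧ ∀ ρ s y, P ρ s y → y ≤ χ ρ s := by
  classical
  let S : ℝ → ℝ → Set ℝ := fun R s => insert 0 {y | ∃ ρ s', P ρ s' y ∧ ρ ≤ R ∧ s ≤ s'}
  let β : ℝ → ℝ → ℝ := fun R s => sSup (S R s)
  have hbdd : ∀ R s, BddAbove (S R s) := by
    intro R s
    obtain ⟨M, hM⟩ := hB (max R 0) (le_max_right _ _)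
    refine ⟨max M 0, ?_⟩
    rintro y (rfl | ⟨ρ, s', h, h1, h2⟩)
    · exact le_max_right _ _
    · exact (hM _ _ _ h (h1.trans (le_max_left _ _))).trans (le_max_left _ _)
  have hne : ∀ R s, (S R s).Nonempty := fun R s => ⟨0, mem_insert _ _⟩
  have hβ0 : ∀ R s, 0 ≤ β R s := fun R s => le_csSup (hbdd R s) (mem_insert _ _)
  have hmono : ∀ s, Monotone (fun R => β R s) := by
    intro s R R' h
    apply csSup_le_csSup (hbdd _ _) (hne _ _)
    apply insert_subset_insert
    rintro y ⟨ρ, s', h0, h1, h2⟩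
    exact ⟨ρ, s', h0, h1.trans h, h2⟩
  have hanti : ∀ R, Antitone (fun s => β R s) := by
    intro R s1 s2 h
    apply csSup_le_csSup (hbdd _ _) (hne _ _)
    apply insert_subset_insert
    rintro y ⟨ρ, s', h0, h1, h2⟩
    exact ⟨ρ, s', h0, h1, h.trans h2⟩
  have hle : ∀ R s ε, 0 ≤ ε → (∀ ρ s' y, P ρ s' y → ρ ≤ R → s ≤ s' → y ≤ ε) → β R s ≤ ε := by
    intro R s ε hε h
    apply csSup_le (hne _ _)
    rintro y (rfl | ⟨ρ, s', h0, h1, h2⟩)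
    · exact hε
    · exact h _ _ _ h0 h1 h2
  have hPβ : ∀ ρ s y, P ρ s y → y ≤ β ρ s := fun ρ s y h =>
    le_csSup (hbdd _ _) (mem_insert_of_mem _ ⟨ρ, s, h, le_rfl, le_rfl⟩)
  have hβlim : ∀ R, 0 ≤ R → Tendsto (fun s => β R s) atTop (nhds 0) := by
    intro R hR
    rw [Metric.tendsto_atTop]
    intro ε hε
    obtain ⟨T, hT⟩ := hA R (ε / 2) hR (by positivity)
    refine ⟨T, fun s hs => ?_⟩
    have := hle R s (ε / 2) (by positivity) (fun ρ s' y h h1 h2 => hT ρ s' y h h1 (hs.le.trans h2))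
    rw [Real.dist_eq, sub_zero, abs_of_nonneg (hβ0 _ _)]
    linarith
  have hβz : ∀ s ε, 0 < ε → ∃ δ, 0 < δ ∧ β δ s ≤ ε := by
    intro s ε hε
    obtain ⟨δ, hδ, h⟩ := hS ε hε
    exact ⟨δ, hδ, hle _ _ _ hε.le (fun ρ s' y h0 h1 _ => h _ _ _ h0 h1)⟩
  have hβ00 : ∀ s, β 0 s = 0 := by
    intro s
    apply le_antisymm _ (hβ0 _ _)
    apply le_of_forall_pos_le_add
    intro ε hε
    obtain ⟨δ, hδ, h⟩ := hβz s ε hε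
    have := hmono s hδ.le
    simp only at this
    linarith
  have hint : ∀ s a b, IntervalIntegrable (fun τ => β τ s) MeasureTheory.volume a b :=
    fun s a b => (hmono s).intervalIntegrable
  have hmono' : ∀ s r, 0 ≤ r → Monotone (fun σ => β (r * σ) s) := fun s r hr x y hxy =>
    hmono s (mul_le_mul_of_nonneg_left hxy hr)
  let I : ℝ → ℝ → ℝ := fun r s => ∫ σ in (1:ℝ)..2, β (r * σ) s
  have hIlow : ∀ r s, 0 ≤ r → β r s ≤ I r s := by
    intro r s hr
    have := intervalIntegral.integral_mono_on (a := 1) (b := 2) (by norm_num)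
      (f := fun _ => β r s) (g := fun σ => β (r * σ) s) (intervalIntegrable_const (μ := MeasureTheory.volume))
      (hmono' s r hr).intervalIntegrable
      (fun x hx => by apply hmono s; nlinarith [hx.1])
    simp only [intervalIntegral.integral_const, smul_eq_mul] at this
    linarith
  have hIup : ∀ r s, 0 ≤ r → I r s ≤ β (r * 2) s := by
    intro r s hr
    have := intervalIntegral.integral_mono_on (a := 1) (b := 2) (by norm_num)
      (g := fun _ => β (r * 2) s) (f := fun σ => β (r * σ) s)
      (hmono' s r hr).intervalIntegrable (intervalIntegrable_const (μ := MeasureTheory.volume))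
      (fun x hx => by apply hmono s; nlinarith [hx.2])
    simp only [intervalIntegral.integral_const, smul_eq_mul] at this
    linarith
  have hImono : ∀ r r' s, 0 ≤ r → r ≤ r' → I r s ≤ I r' s := by
    intro r r' s hr hrr
    exact intervalIntegral.integral_mono_on (a := 1) (b := 2) (by norm_num)
      (hmono' s r hr).intervalIntegrable (hmono' s r' (hr.trans hrr)).intervalIntegrable
      (fun x hx => by apply hmono s; nlinarith [hx.1])
  have hIanti : ∀ r s s', 0 ≤ r → s ≤ s' → I r s' ≤ I r s := by
    intro r s s' hr hss
    exact intervalIntegral.integral_mono_on (a := 1) (b := 2) (by norm_num)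
      (hmono' s' r hr).intervalIntegrable (hmono' s r hr).intervalIntegrable
      (fun x hx => hanti _ hss)
  have hI0 : ∀ s, I 0 s = 0 := by
    intro s
    simp [I, hβ00]
  have hInn : ∀ r s, 0 ≤ r → 0 ≤ I r s := fun r s hr => (hβ0 r s).trans (hIlow r s hr)
  have hIcont : ∀ s, ContinuousOn (fun r => I r s) (Ici 0) := by
    intro s r hr
    rcases eq_or_lt_of_le (show (0:ℝ) ≤ r from hr) with h0 | h0
    · subst h0
      rw [Metric.continuousWithinAt_iff]
      intro ε hε
      obtain ⟨δ, hδ, h⟩ := hβz s (ε / 2) (by positivity)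
      refine ⟨δ / 2, by positivity, fun {x} hx hd => ?_⟩
      have hx0 : (0:ℝ) ≤ x := hx
      rw [Real.dist_eq, sub_zero, abs_of_nonneg hx0] at hd
      rw [Real.dist_eq, hI0, sub_zero, abs_of_nonneg (hInn x s hx0)]
      have h1 := hIup x s hx0
      have h2 : β (x * 2) s ≤ β δ s := hmono s (by linarith)
      linarith
    · apply ContinuousAt.continuousWithinAt
      have hF : Continuous (fun b => ∫ τ in (0:ℝ)..b, β τ s) :=
        intervalIntegral.continuous_primitive (fun a b => hint s a b) 0
      have heq : (fun r => I r s) =ᶠ[nhds r] fun r =>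
          r⁻¹ * ((∫ τ in (0:ℝ)..(r * 2), β τ s) - ∫ τ in (0:ℝ)..r, β τ s) := by
        filter_upwards [lt_mem_nhds h0] with x hx
        rw [intervalIntegral.integral_interval_sub_left (hint _ _ _) (hint _ _ _)]
        have := intervalIntegral.integral_comp_mul_left (a := 1) (b := 2)
          (fun τ => β τ s) hx.ne'
        simp only [I]
        rw [this]
        simp
      refine ContinuousAt.congr ?_ heq.symm
      have h2 : Continuous (fun r : ℝ => ∫ τ in (0:ℝ)..(r * 2), β τ s) :=
        hF.comp (by fun_prop)
      exact (continuousAt_inv₀ h0.ne').mul (h2.continuousAt.sub hF.continuousAt)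
  refine ⟨fun r s => I r s + r * Real.exp (-s), ⟨?_, ?_, ?_⟩, ?_⟩
  · intro s _
    refine ⟨(hIcont s).add (by fun_prop), ?_, by simp [hI0]⟩
    intro x hx y hy hxy
    have := hImono x y s hx hxy.le
    have := mul_lt_mul_of_pos_right hxy (Real.exp_pos (-s))
    simp only
    linarith
  · intro r hr x _ y _ hxy
    have := hIanti r x y hr hxy
    have := mul_le_mul_of_nonneg_left (Real.exp_le_exp.2 (neg_le_neg hxy)) hr
    simp only
    linarith
  · intro r hr
    have h1 : Tendsto (fun s => I r s) atTop (nhds 0) :=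
      squeeze_zero (fun s => hInn r s hr) (fun s => hIup r s hr) (hβlim _ (by positivity))
    have h2 : Tendsto (fun s => r * Real.exp (-s)) atTop (nhds (r * 0)) :=
      (Real.tendsto_exp_neg_atTop_nhds_zero).const_mul r
    simpa using h1.add h2
  · intro ρ s y h
    have h1 := hPβ ρ s y h
    have h2 := hIlow ρ s (hρ _ _ _ h)
    have h3 := mul_nonneg (hρ _ _ _ h) (Real.exp_pos (-s)).le
    simp only
    linarith

/-- Solutions of the closed loop. -/
def IsSol (k₁ k₂ k₃ k₄ : ℝ) (f : ℝ → ℝ) (t₀ : ℝ) (z ψ u r : ℝ → ℝ) : Prop :=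
  ∀ t, t₀ ≤ t →
          HasDerivAt z (-(u t * r t)) t ∧
          HasDerivAt ψ (r t) t ∧
          HasDerivAt u (k₁ * z t * r t - k₂ * u t) t ∧
          HasDerivAt r (-k₃ * ψ t - k₄ * r t + f (z t) * Real.cos t) t

theorem antitone_aux {g g' : ℝ → ℝ} {t₀ : ℝ} (h : ∀ t, t₀ ≤ t → HasDerivAt g (g' t) t) {T : ℝ}
    (hn : ∀ t, t₀ ≤ t → t ≤ T → g' t ≤ 0) (hT : t₀ ≤ T) : g T ≤ g t₀ := by
  have : AntitoneOn g (Set.Icc t₀ T) := by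
    apply antitoneOn_of_deriv_nonpos (convex_Icc _ _)
    · exact fun x hx => (h x hx.1).continuousAt.continuousWithinAt
    · intro x hx
      rw [interior_Icc] at hx
      exact (h x hx.1.le).differentiableAt.differentiableWithinAt
    · intro x hx
      rw [interior_Icc] at hx
      rw [(h x hx.1.le).deriv]
      exact hn x hx.1.le hx.2.le
  exact this ⟨le_rfl, hT⟩ ⟨hT, le_rfl⟩ hT

theorem V_anti {k₁ k₂ k₃ k₄ : ℝ} (hk₂ : 0 < k₂) {f : ℝ → ℝ} {t₀ : ℝ} {z ψ u r : ℝ → ℝ}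
    (h : IsSol k₁ k₂ k₃ k₄ f t₀ z ψ u r) {s t : ℝ} (hs : t₀ ≤ s) (hst : s ≤ t) :
    k₁ * z t ^ 2 + u t ^ 2 ≤ k₁ * z s ^ 2 + u s ^ 2 := by
  refine antitone_aux (g := fun t => k₁ * z t ^ 2 + u t ^ 2) (g' := fun t => - 2 * k₂ * u t ^ 2)
    (t₀ := s) ?_ ?_ hst
  · intro t ht
    obtain ⟨h1, h2, h3, h4⟩ := h t (hs.trans ht)
    refine (((h1.pow 2).const_mul k₁).add (h3.pow 2)).congr_deriv ?_
    push_cast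
    ring
  · intro t _ _
    nlinarith [mul_nonneg hk₂.le (sq_nonneg (u t))]

/-- Quadratic Lyapunov function of the linear part. -/
theorem lin_quad (k₃ k₄ : ℝ) (hk₃ : 0 < k₃) (hk₄ : 0 < k₄) :
    ∃ c a b m M : ℝ, 0 < a ∧ 0 < b ∧ 0 < m ∧ 0 < M ∧ ∀ p r w : ℝ,
      m * (p ^ 2 + r ^ 2) ≤ k₃ * p ^ 2 + r ^ 2 + 2 * c * p * r ∧
      k₃ * p ^ 2 + r ^ 2 + 2 * c * p * r ≤ M * (p ^ 2 + r ^ 2) ∧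
      2 * k₃ * p * r + 2 * r * (-k₃ * p - k₄ * r + w) + 2 * c * r * r
        + 2 * c * p * (-k₃ * p - k₄ * r + w) ≤
        - a * (k₃ * p ^ 2 + r ^ 2 + 2 * c * p * r) + b * w ^ 2 := by
  obtain ⟨c, hc, hc1, hc2, hc3⟩ : ∃ c : ℝ, 0 < c ∧ c ≤ k₄ / 4 ∧ c * (4 * k₄) ≤ k₃ ∧
      c ^ 2 * 4 ≤ k₃ := by
    refine ⟨min (k₄ / 4) (min (k₃ / (4 * k₄)) (Real.sqrt k₃ / 2)), by positivity,
      min_le_left _ _, ?_, ?_⟩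
    · rw [← le_div_iff₀ (by positivity)]
      exact (min_le_right _ _).trans (min_le_left _ _)
    · have h1 : min (k₄ / 4) (min (k₃ / (4 * k₄)) (Real.sqrt k₃ / 2)) ≤ Real.sqrt k₃ / 2 :=
        (min_le_right _ _).trans (min_le_right _ _)
      have h0 : 0 ≤ min (k₄ / 4) (min (k₃ / (4 * k₄)) (Real.sqrt k₃ / 2)) := by positivity
      have h2 := pow_le_pow_left₀ h0 h1 2
      rw [div_pow, Real.sq_sqrt hk₃.le] at h2
      linarith
  have hcross : ∀ p r : ℝ, |2 * c * p * r| ≤ (k₃ * p ^ 2 + r ^ 2) / 2 := by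
    intro p r
    rw [abs_le]
    constructor <;>
    nlinarith [sq_nonneg (r + 2 * c * p), sq_nonneg (r - 2 * c * p),
      mul_le_mul_of_nonneg_right hc3 (sq_nonneg p)]
  refine ⟨c, c / 2, 2 / k₄ + 2 * c / k₃, min k₃ 1 / 2, 2 * max k₃ 1, by positivity,
    by positivity, by positivity, by positivity, ?_⟩
  intro p r w
  have hx := abs_le.1 (hcross p r)
  have e1 := mul_le_mul_of_nonneg_right (min_le_left k₃ 1) (sq_nonneg p)
  have e2 := mul_le_mul_of_nonneg_right (min_le_right k₃ 1) (sq_nonneg r)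
  have e3 := mul_le_mul_of_nonneg_right (le_max_left k₃ 1) (sq_nonneg p)
  have e4 := mul_le_mul_of_nonneg_right (le_max_right k₃ 1) (sq_nonneg r)
  have p1 := mul_nonneg hk₃.le (sq_nonneg p)
  refine ⟨by nlinarith [sq_nonneg r], by nlinarith [sq_nonneg r], ?_⟩
  -- Young inequalities
  have y1 : 2 * r * w ≤ k₄ / 2 * r ^ 2 + 2 / k₄ * w ^ 2 := by
    have : k₄ / 2 * r ^ 2 + 2 / k₄ * w ^ 2 - 2 * r * w = (k₄ * r - 2 * w) ^ 2 / (2 * k₄) := by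
      field_simp
      ring
    have h2 : 0 ≤ (k₄ * r - 2 * w) ^ 2 / (2 * k₄) := by positivity
    linarith
  have y2 : 2 * c * p * w ≤ c * k₃ / 2 * p ^ 2 + 2 * c / k₃ * w ^ 2 := by
    have : c * k₃ / 2 * p ^ 2 + 2 * c / k₃ * w ^ 2 - 2 * c * p * w
        = c * (k₃ * p - 2 * w) ^ 2 / (2 * k₃) := by
      field_simp
      ring
    have h2 : 0 ≤ c * (k₃ * p - 2 * w) ^ 2 / (2 * k₃) := by positivity
    linarith
  have y3 : - (2 * c * k₄ * p * r) ≤ c * k₃ / 2 * p ^ 2 + k₄ / 2 * r ^ 2 := by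
    have h3 : 0 ≤ (k₃ - c * (4 * k₄)) * (k₄ * r ^ 2) :=
      mul_nonneg (by linarith) (by positivity)
    have h4 : k₃ * (c * k₃ / 2 * p ^ 2 + k₄ / 2 * r ^ 2 + (2 * c * k₄ * p * r))
        = c / 2 * (k₃ * p + 2 * k₄ * r) ^ 2 + (k₃ - c * (4 * k₄)) * (k₄ * r ^ 2) / 2 := by
      ring
    have h5 : 0 ≤ k₃ * (c * k₃ / 2 * p ^ 2 + k₄ / 2 * r ^ 2 + (2 * c * k₄ * p * r)) := by
      rw [h4]; positivity
    have := nonneg_of_mul_nonneg_right h5 hk₃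
    linarith
  have y4 := mul_le_mul_of_nonneg_right hc1 (sq_nonneg r)
  have y5 := mul_le_mul_of_nonneg_left hx.2 hc.le
  nlinarith [mul_nonneg hc.le p1, mul_nonneg hk₄.le (sq_nonneg r), mul_nonneg hc.le (sq_nonneg r)]

/-- ISS estimate for the linear part. -/
theorem lin_iss (k₃ k₄ : ℝ) (hk₃ : 0 < k₃) (hk₄ : 0 < k₄) :
    ∃ a K : ℝ, 0 < a ∧ 0 < K ∧ ∀ (k₁ k₂ : ℝ) (f : ℝ → ℝ) (t₀ : ℝ) (z ψ u r : ℝ → ℝ),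
      IsSol k₁ k₂ k₃ k₄ f t₀ z ψ u r → ∀ s t W, t₀ ≤ s → s ≤ t → 
      (∀ τ, s ≤ τ → f (z τ) ^ 2 ≤ W) →
      ψ t ^ 2 + r t ^ 2 ≤ K * (Real.exp (-(a * (t - s))) * (ψ s ^ 2 + r s ^ 2) + W) := by
  obtain ⟨c, a, b, m, M, ha, hb, hm, hM, H⟩ := lin_quad k₃ k₄ hk₃ hk₄
  refine ⟨a, (M + b / a) / m, ha, by positivity, ?_⟩
  intro k₁ k₂ f t₀ z ψ u r h s t W hs hst hW
  have hW0 : 0 ≤ W := (sq_nonneg _).trans (hW s le_rfl)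
  have key := antitone_aux
    (g := fun t => Real.exp (a * (t - s)) *
      (k₃ * ψ t ^ 2 + r t ^ 2 + 2 * c * ψ t * r t - b * W / a))
    (g' := fun t => Real.exp (a * (t - s)) * (a *
      (k₃ * ψ t ^ 2 + r t ^ 2 + 2 * c * ψ t * r t - b * W / a) +
      (2 * k₃ * ψ t * r t + 2 * r t * (-k₃ * ψ t - k₄ * r t + f (z t) * Real.cos t)
        + 2 * c * r t * r t
        + 2 * c * ψ t * (-k₃ * ψ t - k₄ * r t + f (z t) * Real.cos t)))) (t₀ := s) ?_ ?_ hst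
  · simp only [sub_self, mul_zero, Real.exp_zero, one_mul] at key
    have h1 := (H (ψ t) (r t) 0).1
    have h2 := (H (ψ s) (r s) 0).2.1
    set E := Real.exp (a * (t - s)) with hE
    have hEpos : 0 < E := Real.exp_pos _
    have hEi : Real.exp (-(a * (t - s))) = E⁻¹ := Real.exp_neg _
    rw [hEi]
    set X := ψ t ^ 2 + r t ^ 2
    set Y := ψ s ^ 2 + r s ^ 2 with hY
    have hY0 : 0 ≤ Y := by positivity
    have h3 : E * (m * X - b * W / a) ≤ M * Y := by
      have : E * (m * X - b * W / a) ≤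
        E * (k₃ * ψ t ^ 2 + r t ^ 2 + 2 * c * ψ t * r t - b * W / a) :=
        mul_le_mul_of_nonneg_left (by linarith) hEpos.le
      have : 0 ≤ b * W / a := by positivity
      linarith
    have h4 : m * X ≤ E⁻¹ * (M * Y) + b * W / a := by
      have := (le_div_iff₀' hEpos).2 h3
      rw [div_eq_inv_mul (M * Y)] at this
      linarith
    have h5 : X ≤ (E⁻¹ * (M * Y) + b * W / a) / m := by
      rw [le_div_iff₀ hm]; linarith
    refine h5.trans ?_
    rw [div_mul_eq_mul_div]
    apply div_le_div_of_nonneg_right _ hm.le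
    have e1 : 0 ≤ b / a * (E⁻¹ * Y) := by positivity
    have e2 : 0 ≤ M * W := by positivity
    have e3 : b * W / a = b / a * W := by ring
    rw [e3]
    nlinarith
  · intro t ht
    obtain ⟨h1, h2, h3, h4⟩ := h t (hs.trans ht)
    have hexp : HasDerivAt (fun t => Real.exp (a * (t - s))) (Real.exp (a * (t - s)) * (a * 1)) t :=
      (((hasDerivAt_id t).sub_const s).const_mul a).exp
    have hq := ((((h2.pow 2).const_mul k₃).add (h4.pow 2)).add
      ((h2.const_mul (2 * c)).mul h4)).sub_const (b * W / a)
    refine (hexp.mul hq).congr_deriv ?_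
    simp only [Pi.mul_apply, Pi.pow_apply, Pi.add_apply]
    push_cast
    ring
  · intro t ht _
    have h1 := (H (ψ t) (r t) (f (z t) * Real.cos t)).2.2
    have h2 : (f (z t) * Real.cos t) ^ 2 ≤ W := by
      rw [mul_pow]
      have := hW t ht
      nlinarith [Real.cos_sq_le_one t, sq_nonneg (f (z t))]
    have h3 := mul_le_mul_of_nonneg_left h2 hb.le
    apply mul_nonpos_of_nonneg_of_nonpos (Real.exp_pos _).le
    have h4 : a * (b * W / a) = b * W := by field_simp
    rw [mul_sub, h4]
    linarith

set_option maxHeartbeats 2000000 in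
/-- Uniform attractivity of the `V` part, on bounded sets. -/
theorem V_attr (k₁ k₂ k₃ k₄ : ℝ) (hk₁ : 0 < k₁) (hk₂ : 0 < k₂) (hk₃ : 0 < k₃) (hk₄ : 0 < k₄)
    (f : ℝ → ℝ) (hf : ContDiff ℝ (⊤ : ℕ∞) f) (hf0 : ∀ z : ℝ, f z = 0 ↔ z = 0)
    (R η : ℝ) (hη : 0 < η) :
    ∃ T, 0 ≤ T ∧ ∀ (t₀ : ℝ) (z ψ u r : ℝ → ℝ), IsSol k₁ k₂ k₃ k₄ f t₀ z ψ u r →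
      (∀ t, t₀ ≤ t → |z t| ≤ R ∧ |ψ t| ≤ R ∧ |u t| ≤ R ∧ |r t| ≤ R) →
      ∀ t, t₀ + T ≤ t → k₁ * z t ^ 2 + u t ^ 2 ≤ η := by
  have hfc : Continuous f := hf.continuous
  have hfc' : Continuous (deriv f) := hf.continuous_deriv (by simp)
  have hfd : ∀ x, HasDerivAt f (deriv f x) x := fun x =>
    (hf.differentiable (by simp) x).hasDerivAt
  set A : ℝ := (k₄ + 1 + k₃) ^ 2 / k₁ with hA
  have hA0 : 0 ≤ A := by positivity
  -- the compact box
  let box : Set (ℝ × ℝ × ℝ × ℝ × ℝ × ℝ) := Set.Icc (-R) R ×ˢ Set.Icc (-R) R ×ˢ Set.Icc (-R) R ×ˢ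
    Set.Icc (-R) R ×ˢ Set.Icc (-1) 1 ×ˢ Set.Icc (-1) 1
  have hbox : IsCompact box := isCompact_Icc.prod (isCompact_Icc.prod (isCompact_Icc.prod
    (isCompact_Icc.prod (isCompact_Icc.prod isCompact_Icc))))
  let E : ℝ × ℝ × ℝ × ℝ × ℝ × ℝ → ℝ := fun q =>
    match q with
    | (z, p, u, r, c, s) =>
      A * (k₂ * z * r + u * r ^ 2 - z * (-k₃ * p - k₄ * r + f z * c)) +
      (r * (2 * z * f z + z ^ 2 * deriv f z) * (r * c + k₃ * p * s)
        - r * (2 * z * f z ^ 2 + 2 * z ^ 2 * f z * deriv f z) * (s * c / 2))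
  have hE : Continuous E := by
    simp only [E]
    fun_prop
  let W : ℝ × ℝ × ℝ × ℝ × ℝ × ℝ → ℝ := fun q =>
    match q with
    | (z, p, u, r, c, s) =>
      A * (-(u * z * r)) + (-(z ^ 2 * f z * (r * c + k₃ * p * s)) + z ^ 2 * f z ^ 2 * (s * c / 2))
  have hW : Continuous W := by
    simp only [W]
    fun_prop
  obtain ⟨C, hC⟩ := hbox.exists_bound_of_continuousOn hE.continuousOn
  obtain ⟨N, hN⟩ := hbox.exists_bound_of_continuousOn hW.continuousOn
  -- lower bound of the dissipation
  obtain ⟨δ, hδ, hlow⟩ : ∃ δ : ℝ, 0 < δ ∧ ∀ z u : ℝ, |z| ≤ R → |u| ≤ R →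
      η ≤ k₁ * z ^ 2 + u ^ 2 → 2 * δ ≤ z ^ 2 * f z ^ 2 / 4 + u ^ 2 := by
    let S : Set (ℝ × ℝ) := (Set.Icc (-R) R ×ˢ Set.Icc (-R) R) ∩
      {q | η ≤ k₁ * q.1 ^ 2 + q.2 ^ 2}
    have hS : IsCompact S := (isCompact_Icc.prod isCompact_Icc).inter_right
      (isClosed_le continuous_const (by fun_prop))
    rcases S.eq_empty_or_nonempty with he | hne
    · refine ⟨1, one_pos, fun z u hz hu h => ?_⟩
      have : (z, u) ∈ S := ⟨⟨abs_le.1 hz, abs_le.1 hu⟩, h⟩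
      rw [he] at this
      exact this.elim
    · obtain ⟨q, hq, hmin⟩ := hS.exists_isMinOn hne
        (f := fun q : ℝ × ℝ => q.1 ^ 2 * f q.1 ^ 2 / 4 + q.2 ^ 2) (by fun_prop)
      have hpos : 0 < q.1 ^ 2 * f q.1 ^ 2 / 4 + q.2 ^ 2 := by
        have hq2 : η ≤ k₁ * q.1 ^ 2 + q.2 ^ 2 := hq.2
        by_cases hz : q.1 = 0
        · rw [hz] at hq2 ⊢
          nlinarith
        · have : f q.1 ≠ 0 := fun h => hz ((hf0 _).1 h)
          positivity
      refine ⟨(q.1 ^ 2 * f q.1 ^ 2 / 4 + q.2 ^ 2) / 2, by positivity, fun z u hz hu h => ?_⟩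
      have : (z, u) ∈ S := ⟨⟨abs_le.1 hz, abs_le.1 hu⟩, h⟩
      have := isMinOn_iff.1 hmin _ this
      simp only at this
      linarith
  set B : ℝ := (1 + C ^ 2 / (4 * δ)) / (2 * k₂) with hB
  have hB0 : 0 ≤ B := by positivity
  set M : ℝ := B * ((k₁ + 1) * R ^ 2) + |N| with hM
  have hM0 : 0 ≤ M := by positivity
  refine ⟨2 * M / δ + 1, by positivity, ?_⟩
  intro t₀ z ψ u r h hb t ht
  by_contra hcon
  push Not at hcon
  have hVlow : ∀ s, t₀ ≤ s → s ≤ t → η ≤ k₁ * z s ^ 2 + u s ^ 2 := fun s hs hst =>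
    hcon.le.trans (V_anti hk₂ h hs hst)
  have ht0 : t₀ ≤ t := by
    have : 0 ≤ 2 * M / δ + 1 := by positivity
    linarith
  have hmem : ∀ s, t₀ ≤ s → (z s, ψ s, u s, r s, Real.cos s, Real.sin s) ∈ box := by
    intro s hs
    obtain ⟨h1, h2, h3, h4⟩ := hb s hs
    exact ⟨abs_le.1 h1, abs_le.1 h2, abs_le.1 h3, abs_le.1 h4,
      Real.cos_mem_Icc s, Real.sin_mem_Icc s⟩
  have key := antitone_aux (t₀ := t₀) (T := t)
    (g := fun s => B * (k₁ * z s ^ 2 + u s ^ 2) +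
      W (z s, ψ s, u s, r s, Real.cos s, Real.sin s) + δ * s)
    (g' := fun s => B * (-2 * k₂ * u s ^ 2) + (A * (- k₁ * z s ^ 2 * r s ^ 2)
      - z s ^ 2 * f (z s) ^ 2 / 2
      - z s ^ 2 * f (z s) * r s * (-k₄ * Real.cos s - Real.sin s + k₃ * Real.sin s)
      + u s * E (z s, ψ s, u s, r s, Real.cos s, Real.sin s)) + δ) ?_ ?_ ht0
  · have hΦ : ∀ s, t₀ ≤ s → |B * (k₁ * z s ^ 2 + u s ^ 2) +
      W (z s, ψ s, u s, r s, Real.cos s, Real.sin s)| ≤ M := by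
      intro s hs
      obtain ⟨h1, h2, h3, h4⟩ := hb s hs
      have h5 := hN _ (hmem s hs)
      rw [Real.norm_eq_abs] at h5
      refine (abs_add_le _ _).trans (add_le_add ?_ (h5.trans (le_abs_self _)))
      rw [abs_of_nonneg (by positivity)]
      apply mul_le_mul_of_nonneg_left _ hB0
      have e1 := sq_le_sq' (abs_le.1 h1).1 (abs_le.1 h1).2
      have e3 := sq_le_sq' (abs_le.1 h3).1 (abs_le.1 h3).2
      nlinarith
    have a1 := (abs_le.1 (hΦ t ht0)).1
    have a2 := (abs_le.1 (hΦ t₀ le_rfl)).2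
    have a3 : δ * (t - t₀) ≤ 2 * M := by linarith
    have a4 : δ * (2 * M / δ + 1) ≤ δ * (t - t₀) :=
      mul_le_mul_of_nonneg_left (by linarith) hδ.le
    have a5 : δ * (2 * M / δ + 1) = 2 * M + δ := by field_simp
    linarith
  · intro s hs
    obtain ⟨h1, h2, h3, h4⟩ := h s hs
    have hfz : HasDerivAt (fun s => f (z s)) (deriv f (z s) * -(u s * r s)) s :=
      (hfd (z s)).comp s h1
    have hc := Real.hasDerivAt_cos s
    have hsn := Real.hasDerivAt_sin s
    have d1 := (((h1.pow 2).const_mul k₁).add (h3.pow 2)).const_mul B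
    have d2 := (((h3.mul h1).mul h4).neg).const_mul A
    have d3 := (((h1.pow 2).mul hfz).mul
      ((h4.mul hc).add ((h2.const_mul k₃).mul hsn))).neg
    have d4 := ((h1.pow 2).mul (hfz.pow 2)).mul ((hsn.mul hc).div_const 2)
    have d5 := (hasDerivAt_id s).const_mul δ
    refine ((d1.add (d2.add (d3.add d4))).add d5).congr_deriv ?_
    simp only [E, Pi.mul_apply, Pi.pow_apply, Pi.add_apply]
    have hcs := Real.sin_sq_add_cos_sq s
    have hs2 : Real.sin s ^ 2 = 1 - Real.cos s ^ 2 := by linarith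
    push_cast
    ring_nf
    simp only [hs2]
    ring
  · intro s hs hst
    have hD := hlow (z s) (u s) (hb s hs).1 (hb s hs).2.2.1 (hVlow s hs hst)
    have hEb := hC _ (hmem s hs)
    rw [Real.norm_eq_abs] at hEb
    set e := E (z s, ψ s, u s, r s, Real.cos s, Real.sin s)
    have i1 : B * (-2 * k₂ * u s ^ 2) = - (1 + C ^ 2 / (4 * δ)) * u s ^ 2 := by
      rw [hB]; field_simp
    have i2 : A * (- k₁ * z s ^ 2 * r s ^ 2) = - (k₄ + 1 + k₃) ^ 2 * (z s ^ 2 * r s ^ 2) := by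
      rw [hA]; field_simp
    have i3 : u s * e ≤ δ + C ^ 2 / (4 * δ) * u s ^ 2 := by
      have j1 : u s * e ≤ |u s| * C :=
        (le_abs_self _).trans ((abs_mul _ _).le.trans
          (mul_le_mul_of_nonneg_left hEb (abs_nonneg _)))
      have j2 : δ + C ^ 2 / (4 * δ) * |u s| ^ 2 - |u s| * C
        = (2 * δ - C * |u s|) ^ 2 / (4 * δ) := by
        field_simp
        ring
      have j3 : 0 ≤ (2 * δ - C * |u s|) ^ 2 / (4 * δ) := by positivity
      rw [sq_abs] at j2
      linarith
    have i4 : - (z s ^ 2 * f (z s) * r s * (-k₄ * Real.cos s - Real.sin s + k₃ * Real.sin s)) ≤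
        z s ^ 2 * f (z s) ^ 2 / 4 + (k₄ + 1 + k₃) ^ 2 * (z s ^ 2 * r s ^ 2) := by
      set q := -k₄ * Real.cos s - Real.sin s + k₃ * Real.sin s with hq
      have j1 : q ^ 2 ≤ (k₄ + 1 + k₃) ^ 2 := by
        have c1 := Real.cos_le_one s
        have c2 := Real.neg_one_le_cos s
        have c3 := Real.sin_le_one s
        have c4 := Real.neg_one_le_sin s
        apply sq_le_sq' <;> rw [hq] <;> nlinarith
      have j2 := mul_le_mul_of_nonneg_right j1 (show 0 ≤ z s ^ 2 * r s ^ 2 by positivity)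
      nlinarith [sq_nonneg (z s * f (z s) / 2 + z s * r s * q)]
    rw [i1, i2]
    linarith

/-- The closed-loop stabilization subsystem
ż = −ū r, ψ̇ = r, ū̇ = k₁ z r − k₂ ū, ṙ = −k₃ ψ − k₄ r + f(z) cos t
is globally uniformly asymptotically stable. -/
theorem stmt0 (k₁ k₂ k₃ k₄ : ℝ) (hk₁ : 0 < k₁) (hk₂ : 0 < k₂) (hk₃ : 0 < k₃) (hk₄ : 0 < k₄)
    (f : ℝ → ℝ) (hf : ContDiff ℝ (⊤ : ℕ∞) f) (hf0 : ∀ z : ℝ, f z = 0 ↔ z = 0) :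
    ∃ χ : ℝ → ℝ → ℝ, IsClassKL χ ∧
      ∀ t₀ : ℝ, ∀ z ψ u r : ℝ → ℝ,
        (∀ t, t₀ ≤ t →
          HasDerivAt z (-(u t * r t)) t ∧
          HasDerivAt ψ (r t) t ∧
          HasDerivAt u (k₁ * z t * r t - k₂ * u t) t ∧
          HasDerivAt r (-k₃ * ψ t - k₄ * r t + f (z t) * Real.cos t) t) →
        ∀ t, t₀ ≤ t →
          norm4 (z t) (ψ t) (u t) (r t) ≤
            χ (norm4 (z t₀) (ψ t₀) (u t₀) (r t₀)) (t - t₀) := by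
  obtain ⟨a, K, ha, hK, hiss⟩ := lin_iss k₃ k₄ hk₃ hk₄
  have hfc : Continuous f := hf.continuous
  have hf00 : f 0 = 0 := (hf0 0).2 rfl
  let L : ℝ := (k₁ + 1) / k₁ + (k₁ + 1)
  have hL : 0 < L := by positivity
  have hloc : ∀ ε, 0 < ε → ∃ δ, 0 < δ ∧ ∀ x : ℝ, x ^ 2 ≤ δ → f x ^ 2 ≤ ε := by
    intro ε hε
    have hc : ContinuousAt (fun x => f x ^ 2) 0 := (hfc.pow 2).continuousAt
    obtain ⟨d, hd, h⟩ := Metric.continuousAt_iff.1 hc ε hε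
    refine ⟨(d / 2) ^ 2, by positivity, fun x hx => ?_⟩
    have h1 : |x| ≤ d / 2 := abs_le_of_sq_le_sq hx (by positivity)
    have h2 := h (x := x) (by rw [Real.dist_eq, sub_zero]; linarith)
    rw [Real.dist_eq, hf00] at h2
    have := le_abs_self (f x ^ 2 - 0 ^ 2)
    linarith
  have hbdd : ∀ v : ℝ, ∃ F, 0 ≤ F ∧ ∀ x : ℝ, x ^ 2 ≤ v → f x ^ 2 ≤ F := by
    intro v
    obtain ⟨F, hF⟩ := (isCompact_Icc (a := -Real.sqrt v) (b := Real.sqrt v)).exists_bound_of_continuousOn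
      (f := fun x => f x ^ 2) (by fun_prop)
    refine ⟨max F 0, le_max_right _ _, fun x hx => ?_⟩
    have h1 := hF x (abs_le.1 (Real.abs_le_sqrt hx))
    exact ((le_abs_self _).trans h1).trans (le_max_left _ _)
  have hsz : ∀ x y v : ℝ, k₁ * x ^ 2 + y ^ 2 ≤ v → x ^ 2 ≤ v / k₁ ∧ y ^ 2 ≤ v := by
    intro x y v h
    refine ⟨?_, ?_⟩
    · rw [le_div_iff₀ hk₁]
      nlinarith [sq_nonneg y]
    · nlinarith [mul_nonneg hk₁.le (sq_nonneg x)]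
  have hn2 : ∀ x y w v R : ℝ, 0 ≤ R → (norm4 x y w v ≤ R ↔ x ^ 2 + y ^ 2 + w ^ 2 + v ^ 2 ≤ R ^ 2) :=
    fun x y w v R hR => Real.sqrt_le_left hR
  have hV0 : ∀ R t₀ (z ψ u r : ℝ → ℝ), 0 ≤ R → IsSol k₁ k₂ k₃ k₄ f t₀ z ψ u r →
      norm4 (z t₀) (ψ t₀) (u t₀) (r t₀) ≤ R → ∀ t, t₀ ≤ t →
      k₁ * z t ^ 2 + u t ^ 2 ≤ (k₁ + 1) * R ^ 2 := by
    intro R t₀ z ψ u r hR h hn t ht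
    rw [hn2 _ _ _ _ _ hR] at hn
    have := V_anti hk₂ h le_rfl ht
    have h1 : u t₀ ^ 2 ≤ R ^ 2 := by nlinarith [sq_nonneg (z t₀), sq_nonneg (ψ t₀), sq_nonneg (r t₀)]
    have h2 : z t₀ ^ 2 ≤ R ^ 2 := by nlinarith [sq_nonneg (u t₀), sq_nonneg (ψ t₀), sq_nonneg (r t₀)]
    nlinarith
  -- uniform bound
  have hbound : ∀ R F t₀ (z ψ u r : ℝ → ℝ), 0 ≤ R → IsSol k₁ k₂ k₃ k₄ f t₀ z ψ u r →
      norm4 (z t₀) (ψ t₀) (u t₀) (r t₀) ≤ R →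
      (∀ x : ℝ, x ^ 2 ≤ (k₁ + 1) * R ^ 2 / k₁ → f x ^ 2 ≤ F) → ∀ t, t₀ ≤ t →
      z t ^ 2 + ψ t ^ 2 + u t ^ 2 + r t ^ 2 ≤ (L + K) * R ^ 2 + K * F := by
    intro R F t₀ z ψ u r hR h hn hF t ht
    have h1 := hiss k₁ k₂ f t₀ z ψ u r h t₀ t F le_rfl ht
      (fun τ hτ => hF _ (hsz _ _ _ (hV0 R t₀ z ψ u r hR h hn τ hτ)).1)
    obtain ⟨h2, h3⟩ := hsz _ _ _ (hV0 R t₀ z ψ u r hR h hn t ht)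
    rw [hn2 _ _ _ _ _ hR] at hn
    have h4 : Real.exp (-(a * (t - t₀))) * (ψ t₀ ^ 2 + r t₀ ^ 2) ≤ R ^ 2 := by
      have e1 : Real.exp (-(a * (t - t₀))) ≤ 1 := by
        rw [Real.exp_le_one_iff]
        have := mul_nonneg ha.le (sub_nonneg.2 ht)
        linarith
      have e2 : 0 ≤ ψ t₀ ^ 2 + r t₀ ^ 2 := by positivity
      nlinarith [sq_nonneg (u t₀), sq_nonneg (z t₀)]
    have h5 := mul_le_mul_of_nonneg_left h4 hK.le
    have h6 : L * R ^ 2 = (k₁ + 1) * R ^ 2 / k₁ + (k₁ + 1) * R ^ 2 := by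
      simp only [L]; ring
    linarith
  have hB : ∀ R, 0 ≤ R → ∃ M, 0 ≤ M ∧ ∀ t₀ (z ψ u r : ℝ → ℝ), IsSol k₁ k₂ k₃ k₄ f t₀ z ψ u r →
      norm4 (z t₀) (ψ t₀) (u t₀) (r t₀) ≤ R → ∀ t, t₀ ≤ t →
      z t ^ 2 + ψ t ^ 2 + u t ^ 2 + r t ^ 2 ≤ M ^ 2 := by
    intro R hR
    obtain ⟨F, hF0, hF⟩ := hbdd ((k₁ + 1) * R ^ 2 / k₁)
    refine ⟨Real.sqrt ((L + K) * R ^ 2 + K * F), Real.sqrt_nonneg _, ?_⟩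
    intro t₀ z ψ u r h hn t ht
    rw [Real.sq_sqrt (by positivity)]
    exact hbound R F t₀ z ψ u r hR h hn hF t ht
  let P : ℝ → ℝ → ℝ → Prop := (fun ρ s y => ∃ t₀, ∃ z ψ u r : ℝ → ℝ,
      IsSol k₁ k₂ k₃ k₄ f t₀ z ψ u r ∧ 0 ≤ s ∧ norm4 (z t₀) (ψ t₀) (u t₀) (r t₀) = ρ ∧
      norm4 (z (t₀ + s)) (ψ (t₀ + s)) (u (t₀ + s)) (r (t₀ + s)) = y)
  suffices hsuff : ∃ χ : ℝ → ℝ → ℝ, IsClassKL χ ∧ ∀ ρ s y, P ρ s y → y ≤ χ ρ s by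
    obtain ⟨χ, hχ, hmain⟩ := hsuff
    refine ⟨χ, hχ, fun t₀ z ψ u r h t ht => ?_⟩
    exact hmain _ _ _ ⟨t₀, z, ψ, u, r, h, sub_nonneg.2 ht, rfl, by rw [add_sub_cancel]⟩
  refine kl_aux P ?_ ?_ ?_ ?_
  · rintro ρ s y ⟨t₀, z, ψ, u, r, h, hs, rfl, rfl⟩
    exact Real.sqrt_nonneg _
  · intro R hR
    obtain ⟨M, hM0, hM⟩ := hB R hR
    refine ⟨M, ?_⟩
    rintro ρ s y ⟨t₀, z, ψ, u, r, h, hs, rfl, rfl⟩ hn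
    rw [hn2 _ _ _ _ _ hM0]
    exact hM t₀ z ψ u r h hn _ (by linarith)
  · intro ε hε
    obtain ⟨d, hd, hF⟩ := hloc (ε ^ 2 / (4 * K)) (by positivity)
    have hLK : 0 < L + K := by positivity
    have hm : 0 < min d (ε ^ 2 / 2) := by positivity
    refine ⟨Real.sqrt (min d (ε ^ 2 / 2) / (L + K)), by positivity, ?_⟩
    rintro ρ s y ⟨t₀, z, ψ, u, r, h, hs, rfl, rfl⟩ hn
    rw [hn2 _ _ _ _ _ hε.le]
    set R := Real.sqrt (min d (ε ^ 2 / 2) / (L + K)) with hRdef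
    have hR0 : 0 ≤ R := Real.sqrt_nonneg _
    have hR2 : (L + K) * R ^ 2 = min d (ε ^ 2 / 2) := by
      rw [hRdef, Real.sq_sqrt (by positivity)]
      field_simp
    have hd1 : (k₁ + 1) * R ^ 2 / k₁ ≤ d := by
      have e1 : (k₁ + 1) * R ^ 2 / k₁ = (k₁ + 1) / k₁ * R ^ 2 := by ring
      have e2 : (k₁ + 1) / k₁ * R ^ 2 ≤ (L + K) * R ^ 2 := by
        apply mul_le_mul_of_nonneg_right _ (sq_nonneg R)
        simp only [L]
        linarith
      rw [e1]
      exact (e2.trans hR2.le).trans (min_le_left _ _)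
    have := hbound R (ε ^ 2 / (4 * K)) t₀ z ψ u r hR0 h hn
      (fun x hx => hF x (hx.trans hd1)) (t₀ + s) (by linarith)
    have e3 : K * (ε ^ 2 / (4 * K)) = ε ^ 2 / 4 := by field_simp
    have e4 := min_le_right d (ε ^ 2 / 2)
    nlinarith [sq_nonneg ε]
  · intro R ε hR hε
    obtain ⟨M, hM0, hM⟩ := hB R hR
    obtain ⟨d, hd, hF⟩ := hloc (ε ^ 2 / (4 * K)) (by positivity)
    let η : ℝ := min (k₁ * d) (ε ^ 2 / 4 / (1 / k₁ + 1))
    have hη : 0 < η := by positivity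
    obtain ⟨T₁, hT₁, hV⟩ := V_attr k₁ k₂ k₃ k₄ hk₁ hk₂ hk₃ hk₄ f hf hf0 M η hη
    obtain ⟨T₂, hT₂⟩ : ∃ T₂, ∀ x, T₂ ≤ x → K * M ^ 2 * Real.exp (-(a * x)) ≤ ε ^ 2 / 4 := by
      have h1 : Tendsto (fun x => K * M ^ 2 * Real.exp (-(a * x))) atTop (nhds (K * M ^ 2 * 0)) :=
        (Real.tendsto_exp_neg_atTop_nhds_zero.comp
          (tendsto_id.const_mul_atTop ha)).const_mul _
      rw [mul_zero] at h1
      exact eventually_atTop.1 (h1.eventually_le_const (by positivity))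
    refine ⟨T₁ + max T₂ 0, ?_⟩
    rintro ρ s y ⟨t₀, z, ψ, u, r, h, hs, rfl, rfl⟩ hn hT
    rw [hn2 _ _ _ _ _ hε.le]
    have m1 := le_max_left T₂ 0
    have m2 := le_max_right T₂ 0
    have hVη := hV t₀ z ψ u r h (fun t ht => by
      have := hM t₀ z ψ u r h hn t ht
      have q1 := sq_nonneg (z t)
      have q2 := sq_nonneg (ψ t)
      have q3 := sq_nonneg (u t)
      have q4 := sq_nonneg (r t)
      exact ⟨abs_le_of_sq_le_sq (by linarith) hM0, abs_le_of_sq_le_sq (by linarith) hM0,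
        abs_le_of_sq_le_sq (by linarith) hM0, abs_le_of_sq_le_sq (by linarith) hM0⟩)
    have hηd : η / k₁ ≤ d := by
      rw [div_le_iff₀ hk₁]
      linarith [min_le_left (k₁ * d) (ε ^ 2 / 4 / (1 / k₁ + 1))]
    have hηε : η / k₁ + η ≤ ε ^ 2 / 4 := by
      have e1 : η ≤ ε ^ 2 / 4 / (1 / k₁ + 1) := min_le_right _ _
      rw [le_div_iff₀ (by positivity)] at e1
      have e2 : η * (1 / k₁ + 1) = η / k₁ + η := by ring
      linarith
    have h1 := hiss k₁ k₂ f t₀ z ψ u r h (t₀ + T₁) (t₀ + s) (ε ^ 2 / (4 * K)) (by linarith)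
      (by linarith) (fun τ hτ => hF _ ((hsz _ _ _ (hVη τ hτ)).1.trans hηd))
    obtain ⟨h2, h3⟩ := hsz _ _ _ (hVη (t₀ + s) (by linarith))
    have h4 := hT₂ (t₀ + s - (t₀ + T₁)) (by linarith)
    have h5 : ψ (t₀ + T₁) ^ 2 + r (t₀ + T₁) ^ 2 ≤ M ^ 2 := by
      have := hM t₀ z ψ u r h hn (t₀ + T₁) (by linarith)
      linarith [sq_nonneg (z (t₀ + T₁)), sq_nonneg (u (t₀ + T₁))]
    have h6 := mul_le_mul_of_nonneg_left h5
      (mul_nonneg hK.le (Real.exp_pos (-(a * (t₀ + s - (t₀ + T₁))))).le)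
    have e3 : K * (ε ^ 2 / (4 * K)) = ε ^ 2 / 4 := by field_simp
    nlinarith [sq_nonneg ε]
end

section
/- Fix constants a, b ∈ ℝ and c, d > 0, gains k₁, k₂, k₃, k₄ > 0, and a C^∞ function f : ℝ → ℝ with f(z) = 0 if and only if z = 0. Then the full closed-loop stabilization system on ℝ⁶ in the state (x̄, v̄, z, ψ, ū, r), given by x̄̇ = (ū − d x̄)/c + (z − v̄) r/d, v̄̇ = −(ū − d x̄) r − d(v̄ − a r − b ψ), ż = −ū r, ψ̇ = r, ū̇ = k₁ z r − k₂ ū, ṙ = −k₃ ψ − k₄ r + f(z) cos t, is globally uniformly asymptotically stable: there exists a class-κℓ function χ such that for every t₀ ∈ ℝ, every solution on [t₀,∞) satisfies ‖(x̄(t), v̄(t), z(t), ψ(t), ū(t), r(t))‖ ≤ χ(‖(x̄(t₀), v̄(t₀), z(t₀), ψ(t₀), ū(t₀), r(t₀))‖, t − t₀) for all t ≥ t₀. -/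
open Real Filter

/-- Euclidean norm on ℝ⁶. -/
noncomputable def norm6 (a b c d e f : ℝ) : ℝ :=
  Real.sqrt (a ^ 2 + b ^ 2 + c ^ 2 + d ^ 2 + e ^ 2 + f ^ 2)

theorem comp_bound (y y' : ℝ → ℝ) (t₀ α β : ℝ) (hα : 0 < α) (hβ : 0 ≤ β)
    (hy : ∀ t, t₀ ≤ t → HasDerivAt y (y' t) t)
    (hy' : ∀ t, t₀ ≤ t → y' t ≤ -α * y t + β) (h0 : 0 ≤ y t₀) :
    ∀ t, t₀ ≤ t → y t ≤ y t₀ + β / α := by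
  intro t ht
  have hd : ∀ s, t₀ ≤ s → HasDerivAt (fun s => (y s - β / α) * Real.exp (α * (s - t₀)))
      ((y' s) * Real.exp (α * (s - t₀)) + (y s - β / α) * (Real.exp (α * (s - t₀)) * α)) s := by
    intro s hs
    have h1 : HasDerivAt (fun s => α * (s - t₀)) α s := by
      simpa using ((hasDerivAt_id s).sub_const t₀).const_mul α
    exact ((hy s hs).sub_const _).mul h1.exp
  have hanti : AntitoneOn (fun s => (y s - β / α) * Real.exp (α * (s - t₀))) (Set.Ici t₀) := by
    apply antitoneOn_of_deriv_nonpos (convex_Ici t₀)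
    · intro s hs
      exact (hd s hs).continuousAt.continuousWithinAt
    · intro s hs
      rw [interior_Ici] at hs
      exact (hd s hs.le).differentiableAt.differentiableWithinAt
    · intro s hs
      rw [interior_Ici] at hs
      rw [(hd s hs.le).deriv]
      have h1 := hy' s hs.le
      have h2 := Real.exp_pos (α * (s - t₀))
      have h3 : y' s + (y s - β / α) * α ≤ 0 := by
        have : β / α * α = β := by field_simp
        nlinarith
      nlinarith
  have h := hanti (Set.mem_Ici.2 le_rfl) (Set.mem_Ici.2 ht) ht
  simp only [sub_self, mul_zero, Real.exp_zero, mul_one] at h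
  have hb : 0 ≤ β / α := by positivity
  have he : 1 ≤ Real.exp (α * (t - t₀)) := Real.one_le_exp (by nlinarith)
  by_contra hcon
  push Not at hcon
  nlinarith

theorem step_lemma {X : Type*} [TopologicalSpace X] (K : Set X) (hK : IsCompact K)
    (F G : X → ℝ) (hF : Continuous F) (hG : Continuous G)
    (h1 : ∀ p ∈ K, F p ≤ 0) (h2 : ∀ p ∈ K, F p = 0 → G p < 0) :
    ∃ N : ℝ, ∀ p ∈ K, N * F p + G p < 0 := by
  have hK' : IsCompact (K ∩ {p | 0 ≤ G p}) := hK.inter_right (isClosed_le continuous_const hG)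
  rcases (K ∩ {p | 0 ≤ G p}).eq_empty_or_nonempty with he | hne
  · refine ⟨0, fun p hp => ?_⟩
    by_contra hcon
    have : p ∈ K ∩ {p | 0 ≤ G p} := ⟨hp, by simpa using hcon⟩
    rw [he] at this
    exact this
  · obtain ⟨q, hq, hqm⟩ := hK'.exists_isMaxOn hne hF.continuousOn
    obtain ⟨w, hw, hwm⟩ := hK'.exists_isMaxOn hne hG.continuousOn
    have hFq : F q < 0 := by
      rcases (h1 q hq.1).lt_or_eq with h | h
      · exact h
      · exact absurd (h2 q hq.1 h) (not_lt.2 hq.2)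
    have hGw : 0 ≤ G w := hw.2
    refine ⟨(G w + 1) / (-F q), fun p hp => ?_⟩
    have hN : 0 ≤ (G w + 1) / (-F q) := div_nonneg (by linarith) (by linarith)
    by_cases hg : 0 ≤ G p
    · have h3 : F p ≤ F q := hqm ⟨hp, hg⟩
      have h4 : G p ≤ G w := hwm ⟨hp, hg⟩
      have h5 : (G w + 1) / (-F q) * F q = -(G w + 1) := by
        have := hFq.ne
        field_simp
      nlinarith
    · have := h1 p hp
      push Not at hg
      nlinarith

theorem kl_lemma (T : ℝ → (ℝ → ℝ) → Prop)
    (hUB : ∀ R, ∃ M, ∀ t₀ N, T t₀ N → N t₀ ≤ R → ∀ t, t₀ ≤ t → N t ≤ M)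
    (hUS : ∀ ε, 0 < ε → ∃ δ, 0 < δ ∧ ∀ t₀ N, T t₀ N → N t₀ ≤ δ → ∀ t, t₀ ≤ t → N t ≤ ε)
    (hUA : ∀ R ε, 0 < ε → ∃ τ, 0 ≤ τ ∧ ∀ t₀ N, T t₀ N → N t₀ ≤ R → ∀ t, t₀ + τ ≤ t → N t ≤ ε) :
    ∃ χ : ℝ → ℝ → ℝ, IsClassKL χ ∧ ∀ t₀ N, T t₀ N → (0 ≤ N t₀) →
      ∀ t, t₀ ≤ t → N t ≤ χ (N t₀) (t - t₀) := by
  set B : ℝ → ℝ → Set ℝ := fun R s =>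
    insert 0 {y | ∃ t₀ N t, T t₀ N ∧ N t₀ ≤ R ∧ t₀ + s ≤ t ∧ t₀ ≤ t ∧ y = N t} with hB
  set β : ℝ → ℝ → ℝ := fun R s => sSup (B R s) with hβ
  have hbdd : ∀ R s, BddAbove (B R s) := by
    intro R s
    obtain ⟨M, hM⟩ := hUB R
    refine ⟨max M 0, ?_⟩
    rintro y (rfl | ⟨t₀, N, t, h1, h2, h3, h4, rfl⟩)
    · exact le_max_right _ _
    · exact (hM t₀ N h1 h2 t h4).trans (le_max_left _ _)
  have hne : ∀ R s, (B R s).Nonempty := fun R s => ⟨0, Set.mem_insert _ _⟩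
  have hβ0 : ∀ R s, 0 ≤ β R s := fun R s => le_csSup (hbdd R s) (Set.mem_insert _ _)
  have hmono : ∀ s, Monotone (fun R => β R s) := by
    intro s R R' hR
    apply csSup_le_csSup (hbdd R' s) (hne R s)
    apply Set.insert_subset_insert
    rintro y ⟨t₀, N, t, h1, h2, h3⟩
    exact ⟨t₀, N, t, h1, h2.trans hR, h3⟩
  have hanti : ∀ R, Antitone (fun s => β R s) := by
    intro R s s' hs
    apply csSup_le_csSup (hbdd R s) (hne R s')
    apply Set.insert_subset_insert
    rintro y ⟨t₀, N, t, h1, h2, h3, h4⟩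
    exact ⟨t₀, N, t, h1, h2, by linarith, h4⟩
  have hsmall : ∀ ε, 0 < ε → ∃ δ, 0 < δ ∧ ∀ R, R ≤ δ → ∀ s, β R s ≤ ε := by
    intro ε hε
    obtain ⟨δ, hδ, h⟩ := hUS ε hε
    refine ⟨δ, hδ, fun R hR s => csSup_le (hne R s) ?_⟩
    rintro y (rfl | ⟨t₀, N, t, h1, h2, h3, h4, rfl⟩)
    · exact hε.le
    · exact h t₀ N h1 (h2.trans hR) t h4
  have hlate : ∀ R ε, 0 < ε → ∃ τ, ∀ s, τ ≤ s → β R s ≤ ε := by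
    intro R ε hε
    obtain ⟨τ, hτ, h⟩ := hUA R ε hε
    refine ⟨τ, fun s hs => csSup_le (hne R s) ?_⟩
    rintro y (rfl | ⟨t₀, N, t, h1, h2, h3, h4, rfl⟩)
    · exact hε.le
    · exact h t₀ N h1 h2 t (by linarith)
  set I : ℝ → ℝ → ℝ := fun R s => ∫ x in (1:ℝ)..2, β (R * x) s with hI
  have hint : ∀ R, 0 ≤ R → ∀ s, IntervalIntegrable (fun x => β (R * x) s) MeasureTheory.volume 1 2 := by
    intro R hR s
    apply Monotone.intervalIntegrable
    intro x y hxy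
    exact hmono s (mul_le_mul_of_nonneg_left hxy hR)
  have hlow : ∀ R, 0 ≤ R → ∀ s, β R s ≤ I R s := by
    intro R hR s
    have := intervalIntegral.integral_mono_on (a := (1:ℝ)) (b := 2) (by norm_num)
      (intervalIntegrable_const (c := β R s)) (hint R hR s)
      (fun x hx => hmono s (by nlinarith [hx.1] : R ≤ R * x))
    simp only [intervalIntegral.integral_const, smul_eq_mul] at this
    simp only [hI]
    linarith
  have hup : ∀ R, 0 ≤ R → ∀ s, I R s ≤ β (R * 2) s := by
    intro R hR s
    have := intervalIntegral.integral_mono_on (a := (1:ℝ)) (b := 2) (by norm_num)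
      (hint R hR s) (intervalIntegrable_const (c := β (R * 2) s))
      (fun x hx => hmono s (by nlinarith [hx.2] : R * x ≤ R * 2))
    simp only [intervalIntegral.integral_const, smul_eq_mul] at this
    simp only [hI]
    linarith
  have hI0 : ∀ R, 0 ≤ R → ∀ s, 0 ≤ I R s := fun R hR s => (hβ0 R s).trans (hlow R hR s)
  have hImono : ∀ s, MonotoneOn (fun R => I R s) (Set.Ici 0) := by
    intro s R hR R' hR' h
    exact intervalIntegral.integral_mono_on (by norm_num) (hint R hR s) (hint R' hR' s)
      (fun x hx => hmono s (by nlinarith [hx.1] : R * x ≤ R' * x))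
  have hIform : ∀ R, 0 < R → ∀ s, I R s =
      R⁻¹ * ((∫ x in (0:ℝ)..(R * 2), β x s) - ∫ x in (0:ℝ)..(R * 1), β x s) := by
    intro R hR s
    simp only [hI]
    rw [intervalIntegral.integral_comp_mul_left (fun x => β x s) hR.ne',
      intervalIntegral.integral_interval_sub_left]
    · simp
    · exact (hmono s).intervalIntegrable
    · exact (hmono s).intervalIntegrable
  have hIz : ∀ s, I 0 s = 0 := by
    intro s
    apply le_antisymm _ (hI0 0 le_rfl s)
    refine (hup 0 le_rfl s).trans ?_
    apply le_of_forall_pos_le_add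
    intro ε hε
    obtain ⟨δ, hδ, h⟩ := hsmall ε hε
    have := h (0 * 2) (by linarith) s
    linarith
  have hprim : ∀ s, Continuous (fun R => ∫ x in (0:ℝ)..R, β x s) := by
    intro s
    exact intervalIntegral.continuous_primitive (fun a b => (hmono s).intervalIntegrable) 0
  have hIcont : ∀ s, ContinuousOn (fun R => I R s) (Set.Ici 0) := by
    intro s R hR
    rcases (Set.mem_Ici.1 hR).eq_or_lt with h0 | hpos
    · subst h0
      rw [Metric.continuousWithinAt_iff]
      intro ε hε
      obtain ⟨δ, hδ, h⟩ := hsmall (ε / 2) (by linarith)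
      refine ⟨δ / 2, by linarith, fun {x} hx hxd => ?_⟩
      have hx0 : 0 ≤ x := hx
      rw [Real.dist_eq] at hxd ⊢
      rw [sub_zero, abs_of_nonneg hx0] at hxd
      rw [hIz, sub_zero, abs_of_nonneg (hI0 x hx0 s)]
      have := h (x * 2) (by linarith) s
      have := hup x hx0 s
      linarith
    · apply ContinuousAt.continuousWithinAt
      have hc : ContinuousAt (fun R => R⁻¹ * ((∫ x in (0:ℝ)..(R * 2), β x s)
          - ∫ x in (0:ℝ)..(R * 1), β x s)) R := by
        apply ContinuousAt.mul (continuousAt_inv₀ hpos.ne')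
        apply Continuous.continuousAt
        exact ((hprim s).comp (continuous_mul_const 2)).sub ((hprim s).comp (continuous_mul_const 1))
      apply hc.congr
      filter_upwards [lt_mem_nhds hpos] with x hx
      exact (hIform x hx s).symm
  refine ⟨fun R s => I R s + R * Real.exp (-s), ⟨?_, ?_, ?_⟩, ?_⟩
  · intro s hs
    refine ⟨?_, ?_, ?_⟩
    · exact (hIcont s).add (by fun_prop)
    · intro R hR R' hR' h
      have h1 := hImono s hR hR' h.le
      have h2 := mul_lt_mul_of_pos_right h (Real.exp_pos (-s))
      simp only at h1 ⊢
      linarith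
    · simp [hIz]
  · intro R hR s hs s' hs' h
    have h1 : I R s' ≤ I R s := intervalIntegral.integral_mono_on (by norm_num)
      (hint R hR s') (hint R hR s) (fun x hx => hanti (R * x) h)
    have h2 : R * Real.exp (-s') ≤ R * Real.exp (-s) :=
      mul_le_mul_of_nonneg_left (Real.exp_le_exp.2 (by linarith)) hR
    simp only
    linarith
  · intro R hR
    have h1 : Tendsto (fun s => I R s) atTop (nhds 0) := by
      rw [Metric.tendsto_atTop]
      intro ε hε
      obtain ⟨τ, hτ⟩ := hlate (R * 2) (ε / 2) (by linarith)
      refine ⟨τ, fun s hs => ?_⟩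
      rw [Real.dist_eq, sub_zero, abs_of_nonneg (hI0 R hR s)]
      have := hτ s hs
      have := hup R hR s
      linarith
    have h2 : Tendsto (fun s : ℝ => R * Real.exp (-s)) atTop (nhds 0) := by
      simpa using (Real.tendsto_exp_neg_atTop_nhds_zero).const_mul R
    simpa using h1.add h2
  · intro t₀ N hT h0 t ht
    have h1 : N t ≤ β (N t₀) (t - t₀) :=
      le_csSup (hbdd _ _) (Set.mem_insert_of_mem _ ⟨t₀, N, t, hT, le_rfl, by linarith, ht, rfl⟩)
    have h2 := hlow (N t₀) h0 (t - t₀)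
    have h3 : 0 ≤ N t₀ * Real.exp (-(t - t₀)) := by positivity
    simp only
    linarith

def Sol (a b c d k₁ k₂ k₃ k₄ : ℝ) (f : ℝ → ℝ) (t₀ : ℝ) (xb vb z ψ u r : ℝ → ℝ) : Prop :=
  ∀ t, t₀ ≤ t →
          HasDerivAt xb ((u t - d * xb t) / c + (z t - vb t) * r t / d) t ∧
          HasDerivAt vb (-(u t - d * xb t) * r t - d * (vb t - a * r t - b * ψ t)) t ∧
          HasDerivAt z (-(u t * r t)) t ∧
          HasDerivAt ψ (r t) t ∧
          HasDerivAt u (k₁ * z t * r t - k₂ * u t) t ∧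
          HasDerivAt r (-k₃ * ψ t - k₄ * r t + f (z t) * Real.cos t) t

def S6 (a b c d e f : ℝ) : ℝ := a ^ 2 + b ^ 2 + c ^ 2 + d ^ 2 + e ^ 2 + f ^ 2

theorem young (p q e : ℝ) (he : 0 < e) : 2 * p * q ≤ e * p ^ 2 + q ^ 2 / e := by
  have h : e * p ^ 2 + q ^ 2 / e - 2 * p * q = (e * p - q) ^ 2 / e := by
    field_simp
    ring
  have : 0 ≤ (e * p - q) ^ 2 / e := by positivity
  linarith

theorem V_bound (a b c d k₁ k₂ k₃ k₄ : ℝ) (hk₂ : 0 < k₂) (f : ℝ → ℝ)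
    (t₀ : ℝ) (xb vb z ψ u r : ℝ → ℝ) (h : Sol a b c d k₁ k₂ k₃ k₄ f t₀ xb vb z ψ u r) :
    ∀ t, t₀ ≤ t → k₁ * z t ^ 2 + u t ^ 2 ≤ k₁ * z t₀ ^ 2 + u t₀ ^ 2 := by
  intro t ht
  have hd : ∀ s, t₀ ≤ s → HasDerivAt (fun s => k₁ * z s ^ 2 + u s ^ 2) (-2 * k₂ * u s ^ 2) s := by
    intro s hs
    obtain ⟨-, -, hz, -, hu, -⟩ := h s hs
    refine HasDerivAt.congr_deriv (((hz.fun_pow 2).const_mul k₁).add (hu.fun_pow 2)) ?_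
    push_cast
    ring
  have hanti : AntitoneOn (fun s => k₁ * z s ^ 2 + u s ^ 2) (Set.Ici t₀) := by
    apply antitoneOn_of_deriv_nonpos (convex_Ici t₀)
    · intro s hs
      exact (hd s hs).continuousAt.continuousWithinAt
    · intro s hs
      rw [interior_Ici] at hs
      exact (hd s hs.le).differentiableAt.differentiableWithinAt
    · intro s hs
      rw [interior_Ici] at hs
      rw [(hd s hs.le).deriv]
      have : 0 ≤ k₂ * u s ^ 2 := by positivity
      linarith
  exact hanti (Set.mem_Ici.2 le_rfl) (Set.mem_Ici.2 ht) ht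

theorem P_deriv (k₃ k₄ : ℝ) (ψ r : ℝ → ℝ) (t h : ℝ) (hψ : HasDerivAt ψ (r t) t)
    (hr : HasDerivAt r (-k₃ * ψ t - k₄ * r t + h) t) :
    HasDerivAt (fun s => (k₃ + k₄ ^ 2 / 2) * ψ s ^ 2 + k₄ * (ψ s * r s) + r s ^ 2)
      (-(k₃ * k₄) * ψ t ^ 2 - k₄ * r t ^ 2 + (k₄ * ψ t + 2 * r t) * h) t := by
  refine HasDerivAt.congr_deriv ((((hψ.fun_pow 2).const_mul (k₃ + k₄ ^ 2 / 2)).add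
    ((hψ.fun_mul hr).const_mul k₄)).add (hr.fun_pow 2)) ?_
  push_cast
  ring

theorem W_deriv (a b c d : ℝ) (hc : 0 < c) (hd : 0 < d) (xb vb : ℝ → ℝ) (t z ψ u r : ℝ)
    (hx : HasDerivAt xb ((u - d * xb t) / c + (z - vb t) * r / d) t)
    (hv : HasDerivAt vb (-(u - d * xb t) * r - d * (vb t - a * r - b * ψ)) t) :
    HasDerivAt (fun s => d ^ 2 * xb s ^ 2 + vb s ^ 2)
      (-(2 * d ^ 3 / c) * xb t ^ 2 - 2 * d * vb t ^ 2 + 2 * xb t * (d ^ 2 * u / c)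
        + 2 * xb t * (d * z * r) - 2 * vb t * (u * r) + 2 * vb t * (d * (a * r + b * ψ))) t := by
  refine HasDerivAt.congr_deriv (((hx.fun_pow 2).const_mul (d ^ 2)).add (hv.fun_pow 2)) ?_
  push_cast
  field_simp
  ring

theorem P_low (k₃ k₄ ψ r : ℝ) (hk₃ : 0 < k₃) :
    k₃ * ψ ^ 2 ≤ (k₃ + k₄ ^ 2 / 2) * ψ ^ 2 + k₄ * (ψ * r) + r ^ 2 ∧
    r ^ 2 ≤ 2 * ((k₃ + k₄ ^ 2 / 2) * ψ ^ 2 + k₄ * (ψ * r) + r ^ 2) := by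
  have : 0 ≤ k₃ * ψ ^ 2 := by positivity
  constructor <;> nlinarith [sq_nonneg (r + k₄ * ψ / 2), sq_nonneg (r + k₄ * ψ), sq_nonneg (k₄ * ψ)]

theorem P_up (k₃ k₄ ψ r : ℝ) :
    (k₃ + k₄ ^ 2 / 2) * ψ ^ 2 + k₄ * (ψ * r) + r ^ 2 ≤ (k₃ + k₄ ^ 2) * ψ ^ 2 + 3 / 2 * r ^ 2 := by
  nlinarith [sq_nonneg (r - k₄ * ψ)]

theorem P_ineq (k₃ k₄ ψ r h : ℝ) (hk₃ : 0 < k₃) (hk₄ : 0 < k₄) :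
    -(k₃ * k₄) * ψ ^ 2 - k₄ * r ^ 2 + (k₄ * ψ + 2 * r) * h ≤
      -(min (k₃ * k₄ / 2 / (k₃ + k₄ ^ 2)) (k₄ / 3)) *
        ((k₃ + k₄ ^ 2 / 2) * ψ ^ 2 + k₄ * (ψ * r) + r ^ 2)
      + (k₄ / (2 * k₃) + 2 / k₄) * h ^ 2 := by
  set α := min (k₃ * k₄ / 2 / (k₃ + k₄ ^ 2)) (k₄ / 3) with hα
  have hα0 : 0 < α := by rw [hα]; positivity
  have h1 : α * (k₃ + k₄ ^ 2) ≤ k₃ * k₄ / 2 := by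
    have : α ≤ k₃ * k₄ / 2 / (k₃ + k₄ ^ 2) := min_le_left _ _
    rwa [le_div_iff₀ (by positivity)] at this
  have h2 : α ≤ k₄ / 3 := min_le_right _ _
  have h3 := mul_le_mul_of_nonneg_left (P_up k₃ k₄ ψ r) hα0.le
  have h4 := mul_le_mul_of_nonneg_right h1 (sq_nonneg ψ)
  have h5 := mul_le_mul_of_nonneg_right h2 (sq_nonneg r)
  have h6 := young ψ (k₄ / 2 * h) (k₃ * k₄ / 2) (by positivity)
  have h7 := young r h (k₄ / 2) (by positivity)
  have e6 : (k₄ / 2 * h) ^ 2 / (k₃ * k₄ / 2) = k₄ / (2 * k₃) * h ^ 2 := by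
    field_simp
  have e7 : h ^ 2 / (k₄ / 2) = 2 / k₄ * h ^ 2 := by
    field_simp
  rw [e6] at h6
  rw [e7] at h7
  nlinarith

theorem W_ineq (a b c d x v z ψ u r Z Q U R : ℝ) (hc : 0 < c) (hd : 0 < d)
    (hz : z ^ 2 ≤ Z) (hψ : ψ ^ 2 ≤ Q) (hu : u ^ 2 ≤ U) (hr : r ^ 2 ≤ R) :
    -(2 * d ^ 3 / c) * x ^ 2 - 2 * d * v ^ 2 + 2 * x * (d ^ 2 * u / c)
        + 2 * x * (d * z * r) - 2 * v * (u * r) + 2 * v * (d * (a * r + b * ψ)) ≤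
      -(min (d / c) d) * (d ^ 2 * x ^ 2 + v ^ 2) +
      (2 * d / c * U + 2 * c / d * (Z * R) + 2 / d * (U * R) +
        2 * d * (2 * a ^ 2 * R + 2 * b ^ 2 * Q)) := by
  set α := min (d / c) d with hα
  have h1 : α ≤ d / c := min_le_left _ _
  have h2 : α ≤ d := min_le_right _ _
  have h3 := mul_le_mul_of_nonneg_right h1 (by positivity : 0 ≤ d ^ 2 * x ^ 2)
  have h4 := mul_le_mul_of_nonneg_right h2 (sq_nonneg v)
  have e3 : d / c * (d ^ 2 * x ^ 2) = d ^ 3 / c * x ^ 2 := by ring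
  have e3' : 2 * d ^ 3 / c * x ^ 2 = 2 * (d ^ 3 / c * x ^ 2) := by ring
  have y1 := young x (d ^ 2 * u / c) (d ^ 3 / (2 * c)) (by positivity)
  have y2 := young x (d * z * r) (d ^ 3 / (2 * c)) (by positivity)
  have y3 := young v (-(u * r)) (d / 2) (by positivity)
  have y4 := young v (d * (a * r + b * ψ)) (d / 2) (by positivity)
  have e1 : (d ^ 2 * u / c) ^ 2 / (d ^ 3 / (2 * c)) = 2 * d / c * u ^ 2 := by
    field_simp
  have e2 : (d * z * r) ^ 2 / (d ^ 3 / (2 * c)) = 2 * c / d * (z ^ 2 * r ^ 2) := by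
    field_simp
  have e5 : (-(u * r)) ^ 2 / (d / 2) = 2 / d * (u ^ 2 * r ^ 2) := by
    field_simp
  have e4 : (d * (a * r + b * ψ)) ^ 2 / (d / 2) = 2 * d * (a * r + b * ψ) ^ 2 := by
    field_simp
  have e0 : d ^ 3 / (2 * c) * x ^ 2 = d ^ 3 / c * x ^ 2 / 2 := by field_simp
  rw [e1, e0] at y1
  rw [e2, e0] at y2
  rw [e5] at y3
  rw [e4] at y4
  have hZ : 0 ≤ Z := (sq_nonneg z).trans hz
  have hU : 0 ≤ U := (sq_nonneg u).trans hu
  have i1 : 2 * d / c * u ^ 2 ≤ 2 * d / c * U := by gcongr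
  have i2 : 2 * c / d * (z ^ 2 * r ^ 2) ≤ 2 * c / d * (Z * R) := by gcongr
  have i3 : 2 / d * (u ^ 2 * r ^ 2) ≤ 2 / d * (U * R) := by gcongr
  have i4 : 2 * d * (a * r + b * ψ) ^ 2 ≤ 2 * d * (2 * a ^ 2 * R + 2 * b ^ 2 * Q) := by
    have : (a * r + b * ψ) ^ 2 ≤ 2 * a ^ 2 * r ^ 2 + 2 * b ^ 2 * ψ ^ 2 := by
      nlinarith [sq_nonneg (a * r - b * ψ)]
    have : 2 * a ^ 2 * r ^ 2 ≤ 2 * a ^ 2 * R := by gcongr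
    have : 2 * b ^ 2 * ψ ^ 2 ≤ 2 * b ^ 2 * Q := by gcongr
    have : (a * r + b * ψ) ^ 2 ≤ 2 * a ^ 2 * R + 2 * b ^ 2 * Q := by linarith
    gcongr
  linarith

theorem S_bound (a b c d k₁ k₂ k₃ k₄ : ℝ) (hc : 0 < c) (hd : 0 < d)
    (hk₁ : 0 < k₁) (hk₂ : 0 < k₂) (hk₃ : 0 < k₃) (hk₄ : 0 < k₄) (f : ℝ → ℝ) :
    ∃ G : ℝ × ℝ → ℝ, Continuous G ∧ G (0, 0) = 0 ∧ ∀ s φ, 0 ≤ s → 0 ≤ φ →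
      (∀ y, y ^ 2 ≤ (k₁ + 1) * s / k₁ → f y ^ 2 ≤ φ) →
      ∀ t₀ xb vb z ψ u r, Sol a b c d k₁ k₂ k₃ k₄ f t₀ xb vb z ψ u r →
        S6 (xb t₀) (vb t₀) (z t₀) (ψ t₀) (u t₀) (r t₀) ≤ s →
        ∀ t, t₀ ≤ t → S6 (xb t) (vb t) (z t) (ψ t) (u t) (r t) ≤ G (s, φ) := by
  set α := min (k₃ * k₄ / 2 / (k₃ + k₄ ^ 2)) (k₄ / 3) with hα
  have hα0 : 0 < α := by rw [hα]; positivity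
  set α' := min (d / c) d with hα'
  have hα0' : 0 < α' := by rw [hα']; positivity
  set C := (k₄ / (2 * k₃) + 2 / k₄) with hC
  have hC0 : 0 < C := by rw [hC]; positivity
  let U : ℝ × ℝ → ℝ := fun p => (k₁ + 1) * p.1
  let Z : ℝ × ℝ → ℝ := fun p => (k₁ + 1) * p.1 / k₁
  let PP : ℝ × ℝ → ℝ := fun p => (k₃ + k₄ ^ 2 + 3 / 2) * p.1 + C * p.2 / α
  let R : ℝ × ℝ → ℝ := fun p => 2 * PP p
  let Q : ℝ × ℝ → ℝ := fun p => PP p / k₃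
  let β : ℝ × ℝ → ℝ := fun p => 2 * d / c * U p + 2 * c / d * (Z p * R p) + 2 / d * (U p * R p) +
        2 * d * (2 * a ^ 2 * R p + 2 * b ^ 2 * Q p)
  let WW : ℝ × ℝ → ℝ := fun p => (d ^ 2 + 1) * p.1 + β p / α'
  refine ⟨fun p => WW p / d ^ 2 + WW p + Z p + Q p + U p + R p, by fun_prop,
    by simp [WW, β, Z, Q, U, R, PP], ?_⟩
  intro s φ hs hφ hf t₀ xb vb z ψ u r hsol h0
  have hx0 := sq_nonneg (xb t₀)
  have hv0 := sq_nonneg (vb t₀)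
  have hz0 := sq_nonneg (z t₀)
  have hψ0 := sq_nonneg (ψ t₀)
  have hu0 := sq_nonneg (u t₀)
  have hr0 := sq_nonneg (r t₀)
  unfold S6 at h0
  have hV : ∀ t, t₀ ≤ t → z t ^ 2 ≤ Z (s, φ) ∧ u t ^ 2 ≤ U (s, φ) := by
    intro t ht
    have h1 := V_bound a b c d k₁ k₂ k₃ k₄ hk₂ f t₀ xb vb z ψ u r hsol t ht
    have h2 : k₁ * z t₀ ^ 2 ≤ k₁ * s := by gcongr; linarith
    have h3 : 0 ≤ k₁ * z t ^ 2 := by positivity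
    have h4 := sq_nonneg (u t)
    refine ⟨?_, ?_⟩
    · simp only [Z]
      rw [le_div_iff₀ hk₁]
      linarith
    · simp only [U]
      linarith
  have hP : ∀ t, t₀ ≤ t →
      (k₃ + k₄ ^ 2 / 2) * ψ t ^ 2 + k₄ * (ψ t * r t) + r t ^ 2 ≤ PP (s, φ) := by
    intro t ht
    have h1 := comp_bound (fun t => (k₃ + k₄ ^ 2 / 2) * ψ t ^ 2 + k₄ * (ψ t * r t) + r t ^ 2)
      _ t₀ α (C * φ) hα0 (by positivity)
      (fun t ht => P_deriv k₃ k₄ ψ r t _ (hsol t ht).2.2.2.1 (hsol t ht).2.2.2.2.2)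
      (by
        intro t ht
        refine (P_ineq k₃ k₄ (ψ t) (r t) _ hk₃ hk₄).trans ?_
        have h1 := hf (z t) (hV t ht).1
        have h2 : (f (z t) * Real.cos t) ^ 2 ≤ φ := by
          rw [mul_pow]
          nlinarith [Real.cos_sq_le_one t, sq_nonneg (f (z t))]
        have h3 := mul_le_mul_of_nonneg_left h2 hC0.le
        linarith)
      (by
        have := (P_low k₃ k₄ (ψ t₀) (r t₀) hk₃).1
        have : 0 ≤ k₃ * ψ t₀ ^ 2 := by positivity
        linarith) t ht
    have h2 := P_up k₃ k₄ (ψ t₀) (r t₀)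
    have h3 : (k₃ + k₄ ^ 2) * ψ t₀ ^ 2 ≤ (k₃ + k₄ ^ 2) * s := by gcongr; linarith
    simp only [PP]
    linarith
  have hQ : ∀ t, t₀ ≤ t → ψ t ^ 2 ≤ Q (s, φ) ∧ r t ^ 2 ≤ R (s, φ) := by
    intro t ht
    obtain ⟨h1, h2⟩ := P_low k₃ k₄ (ψ t) (r t) hk₃
    have h3 := hP t ht
    refine ⟨?_, ?_⟩
    · simp only [Q]
      rw [le_div_iff₀ hk₃]
      linarith
    · simp only [R]
      linarith
  have hZ0 : 0 ≤ Z (s, φ) := by positivity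
  have hU0 : 0 ≤ U (s, φ) := by positivity
  have hP0 : 0 ≤ PP (s, φ) := by positivity
  have hR0 : 0 ≤ R (s, φ) := by positivity
  have hQ0 : 0 ≤ Q (s, φ) := by positivity
  have hβ0 : 0 ≤ β (s, φ) := by positivity
  have hW : ∀ t, t₀ ≤ t → d ^ 2 * xb t ^ 2 + vb t ^ 2 ≤ WW (s, φ) := by
    intro t ht
    have h1 := comp_bound (fun t => d ^ 2 * xb t ^ 2 + vb t ^ 2)
      _ t₀ α' (β (s, φ)) hα0' hβ0
      (fun t ht => W_deriv a b c d hc hd xb vb t (z t) (ψ t) (u t) (r t) (hsol t ht).1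
        (hsol t ht).2.1)
      (fun t ht => W_ineq a b c d (xb t) (vb t) (z t) (ψ t) (u t) (r t) _ _ _ _ hc hd
        (hV t ht).1 (hQ t ht).1 (hV t ht).2 (hQ t ht).2)
      (by positivity) t ht
    have h3 : d ^ 2 * xb t₀ ^ 2 ≤ d ^ 2 * s := by gcongr; linarith
    simp only [WW]
    linarith
  intro t ht
  have h1 := hW t ht
  have h2 := hQ t ht
  have h3 := hV t ht
  have h4 : xb t ^ 2 ≤ WW (s, φ) / d ^ 2 := by
    rw [le_div_iff₀ (by positivity)]
    nlinarith [sq_nonneg (vb t)]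
  have h5 : 0 ≤ d ^ 2 * xb t ^ 2 := by positivity
  unfold S6
  simp only
  linarith [h2.1, h2.2, h3.1, h3.2]

/-- Nested Matrosov combination. -/
theorem matrosov {X : Type*} [TopologicalSpace X] (K : Set X) (hK : IsCompact K)
    (Y₁ Y₂ Y₃ Y₄ Y₅ Y₆ Y₇ : X → ℝ)
    (c1 : Continuous Y₁) (c2 : Continuous Y₂) (c3 : Continuous Y₃) (c4 : Continuous Y₄)
    (c5 : Continuous Y₅) (c6 : Continuous Y₆) (c7 : Continuous Y₇)
    (h1 : ∀ p ∈ K, Y₁ p ≤ 0)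
    (h2 : ∀ p ∈ K, Y₁ p = 0 → Y₂ p ≤ 0)
    (h3 : ∀ p ∈ K, Y₁ p = 0 → Y₂ p = 0 → Y₃ p ≤ 0)
    (h4 : ∀ p ∈ K, Y₁ p = 0 → Y₂ p = 0 → Y₃ p = 0 → Y₄ p ≤ 0)
    (h5 : ∀ p ∈ K, Y₁ p = 0 → Y₂ p = 0 → Y₃ p = 0 → Y₄ p = 0 → Y₅ p ≤ 0)
    (h6 : ∀ p ∈ K, Y₁ p = 0 → Y₂ p = 0 → Y₃ p = 0 → Y₄ p = 0 → Y₅ p = 0 → Y₆ p ≤ 0)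
    (h7 : ∀ p ∈ K, Y₁ p = 0 → Y₂ p = 0 → Y₃ p = 0 → Y₄ p = 0 → Y₅ p = 0 → Y₆ p = 0 → Y₇ p < 0) :
    ∃ N₁ N₂ N₃ N₄ N₅ N₆ : ℝ, ∀ p ∈ K, N₁ * Y₁ p + (N₂ * Y₂ p + (N₃ * Y₃ p + (N₄ * Y₄ p +
      (N₅ * Y₅ p + (N₆ * Y₆ p + Y₇ p))))) < 0 := by
  have hc : ∀ (L : Set X) (F : X → ℝ), IsCompact L → Continuous F →
      IsCompact (L ∩ {p | F p = 0}) := fun L F hL hF =>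
    hL.inter_right (isClosed_eq hF continuous_const)
  have k2 := hc K Y₁ hK c1
  have k3 := hc _ Y₂ k2 c2
  have k4 := hc _ Y₃ k3 c3
  have k5 := hc _ Y₄ k4 c4
  have k6 := hc _ Y₅ k5 c5
  obtain ⟨N₆, g6⟩ := step_lemma _ k6 Y₆ Y₇ c6 c7
    (fun p hp => h6 p hp.1.1.1.1.1 hp.1.1.1.1.2 hp.1.1.1.2 hp.1.1.2 hp.1.2 hp.2)
    (fun p hp => h7 p hp.1.1.1.1.1 hp.1.1.1.1.2 hp.1.1.1.2 hp.1.1.2 hp.1.2 hp.2)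
  obtain ⟨N₅, g5⟩ := step_lemma _ k5 Y₅ (fun p => N₆ * Y₆ p + Y₇ p) c5 (by fun_prop)
    (fun p hp => h5 p hp.1.1.1.1 hp.1.1.1.2 hp.1.1.2 hp.1.2 hp.2)
    (fun p hp h => g6 p ⟨hp, h⟩)
  obtain ⟨N₄, g4⟩ := step_lemma _ k4 Y₄ (fun p => N₅ * Y₅ p + (N₆ * Y₆ p + Y₇ p)) c4 (by fun_prop)
    (fun p hp => h4 p hp.1.1.1 hp.1.1.2 hp.1.2 hp.2)
    (fun p hp h => g5 p ⟨hp, h⟩)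
  obtain ⟨N₃, g3⟩ := step_lemma _ k3 Y₃ (fun p => N₄ * Y₄ p + (N₅ * Y₅ p + (N₆ * Y₆ p + Y₇ p)))
    c3 (by fun_prop)
    (fun p hp => h3 p hp.1.1 hp.1.2 hp.2)
    (fun p hp h => g4 p ⟨hp, h⟩)
  obtain ⟨N₂, g2⟩ := step_lemma _ k2 Y₂
    (fun p => N₃ * Y₃ p + (N₄ * Y₄ p + (N₅ * Y₅ p + (N₆ * Y₆ p + Y₇ p))))
    c2 (by fun_prop)
    (fun p hp => h2 p hp.1 hp.2)
    (fun p hp h => g3 p ⟨hp, h⟩)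
  obtain ⟨N₁, g1⟩ := step_lemma _ hK Y₁
    (fun p => N₂ * Y₂ p + (N₃ * Y₃ p + (N₄ * Y₄ p + (N₅ * Y₅ p + (N₆ * Y₆ p + Y₇ p)))))
    c1 (by fun_prop) h1
    (fun p hp h => g2 p ⟨hp, h⟩)
  exact ⟨N₁, N₂, N₃, N₄, N₅, N₆, g1⟩

/-- A function whose derivative is at most `-δ` along a set, bounded by `C`, must leave it. -/
theorem decrease (w w' : ℝ → ℝ) (t₀ τ δ C : ℝ) (hδ : 0 < δ) (hτ : 0 ≤ τ)
    (hw : ∀ t, t₀ ≤ t → HasDerivAt w (w' t) t)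
    (hw' : ∀ t, t₀ ≤ t → t ≤ t₀ + τ → w' t ≤ -δ)
    (hC : ∀ t, t₀ ≤ t → |w t| ≤ C) : δ * τ ≤ 2 * C := by
  have hd : ∀ s, t₀ ≤ s → HasDerivAt (fun s => w s + δ * s) (w' s + δ) s := by
    intro s hs
    have := (hw s hs).add ((hasDerivAt_id s).const_mul δ)
    simp only [mul_one] at this
    exact this
  have hanti : AntitoneOn (fun s => w s + δ * s) (Set.Icc t₀ (t₀ + τ)) := by
    apply antitoneOn_of_deriv_nonpos (convex_Icc _ _)
    · intro s hs
      exact (hd s hs.1).continuousAt.continuousWithinAt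
    · intro s hs
      rw [interior_Icc] at hs
      exact (hd s hs.1.le).differentiableAt.differentiableWithinAt
    · intro s hs
      rw [interior_Icc] at hs
      rw [(hd s hs.1.le).deriv]
      linarith [hw' s hs.1.le hs.2.le]
  have h := hanti (Set.left_mem_Icc.2 (by linarith)) (Set.right_mem_Icc.2 (by linarith))
    (by linarith : t₀ ≤ t₀ + τ)
  simp only at h
  have h1 := abs_le.1 (hC t₀ le_rfl)
  have h2 := abs_le.1 (hC (t₀ + τ) (by linarith))
  nlinarith [h1.1, h1.2, h2.1, h2.2]

theorem hit (a b c d k₁ k₂ k₃ k₄ : ℝ) (hc : 0 < c) (hd : 0 < d)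
    (hk₁ : 0 < k₁) (hk₂ : 0 < k₂) (hk₃ : 0 < k₃) (hk₄ : 0 < k₄) (f f' : ℝ → ℝ)
    (hf : Continuous f) (hf' : Continuous f') (hff : ∀ y, HasDerivAt f (f' y) y)
    (hf0 : ∀ z : ℝ, f z = 0 ↔ z = 0) (M ε : ℝ) (hε : 0 < ε) :
    ∃ τ, 0 ≤ τ ∧ ∀ t₀ xb vb z ψ u r, Sol a b c d k₁ k₂ k₃ k₄ f t₀ xb vb z ψ u r →
      (∀ t, t₀ ≤ t → S6 (xb t) (vb t) (z t) (ψ t) (u t) (r t) ≤ M) →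
      ∃ t, t₀ ≤ t ∧ t ≤ t₀ + τ ∧ S6 (xb t) (vb t) (z t) (ψ t) (u t) (r t) ≤ ε := by
  let g : (Fin 8 → ℝ) → ℝ := fun p => -k₃ * p 3 + f (p 2) * p 7
  let g' : (Fin 8 → ℝ) → ℝ := fun p => -k₃ * p 5 +
    (f' (p 2) * (-(p 4 * p 5)) * p 7 + f (p 2) * (-p 6))
  let A₁ : (Fin 8 → ℝ) → ℝ := fun p => k₁ * p 2 ^ 2 + p 4 ^ 2
  let A₂ : (Fin 8 → ℝ) → ℝ := fun p => -(p 4 * p 2 * p 5)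
  let A₃ : (Fin 8 → ℝ) → ℝ := fun p => -(p 2 ^ 2 * p 5 * g p)
  let A₄ : (Fin 8 → ℝ) → ℝ := fun p => p 2 ^ 2 * g p * f (p 2) * p 6
  let A₅ : (Fin 8 → ℝ) → ℝ := fun p => -(p 2 ^ 2 * f (p 2) ^ 2 * p 6 * p 7)
  let A₆ : (Fin 8 → ℝ) → ℝ := fun p =>
    (k₃ + k₄ ^ 2 / 2) * p 3 ^ 2 + k₄ * (p 3 * p 5) + p 5 ^ 2
  let A₇ : (Fin 8 → ℝ) → ℝ := fun p => d ^ 2 * p 0 ^ 2 + p 1 ^ 2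
  let Y₁ : (Fin 8 → ℝ) → ℝ := fun p => -2 * k₂ * p 4 ^ 2
  let Y₂ : (Fin 8 → ℝ) → ℝ := fun p => -((k₁ * p 2 * p 5 - k₂ * p 4) * p 2 * p 5
    + p 4 * (-(p 4 * p 5)) * p 5 + p 4 * p 2 * (g p - k₄ * p 5))
  let Y₃ : (Fin 8 → ℝ) → ℝ := fun p => -(2 * p 2 * (-(p 4 * p 5)) * p 5 * g p
    + p 2 ^ 2 * (g p - k₄ * p 5) * g p + p 2 ^ 2 * p 5 * g' p)
  let Y₄ : (Fin 8 → ℝ) → ℝ := fun p => 2 * p 2 * (-(p 4 * p 5)) * g p * f (p 2) * p 6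
    + p 2 ^ 2 * g' p * f (p 2) * p 6 + p 2 ^ 2 * g p * (f' (p 2) * (-(p 4 * p 5))) * p 6
    + p 2 ^ 2 * g p * f (p 2) * p 7
  let Y₅ : (Fin 8 → ℝ) → ℝ := fun p => -(2 * p 2 * (-(p 4 * p 5)) * f (p 2) ^ 2 * p 6 * p 7
    + p 2 ^ 2 * (2 * f (p 2) * (f' (p 2) * (-(p 4 * p 5)))) * p 6 * p 7
    + p 2 ^ 2 * f (p 2) ^ 2 * (p 7 ^ 2 - p 6 ^ 2))
  let Y₆ : (Fin 8 → ℝ) → ℝ := fun p =>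
    -(k₃ * k₄) * p 3 ^ 2 - k₄ * p 5 ^ 2 + (k₄ * p 3 + 2 * p 5) * (f (p 2) * p 7)
  let Y₇ : (Fin 8 → ℝ) → ℝ := fun p =>
    -(2 * d ^ 3 / c) * p 0 ^ 2 - 2 * d * p 1 ^ 2 + 2 * p 0 * (d ^ 2 * p 4 / c)
        + 2 * p 0 * (d * p 2 * p 5) - 2 * p 1 * (p 4 * p 5)
        + 2 * p 1 * (d * (a * p 5 + b * p 3))
  let s6 : (Fin 8 → ℝ) → ℝ := fun p => S6 (p 0) (p 1) (p 2) (p 3) (p 4) (p 5)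
  have cs6 : Continuous s6 := by simp only [s6, S6]; fun_prop
  let K₀ : Set (Fin 8 → ℝ) := Metric.closedBall 0 (max M 1 + 1)
  have hK₀ : IsCompact K₀ := isCompact_closedBall _ _
  let K : Set (Fin 8 → ℝ) := K₀ ∩ {p | ε ≤ s6 p} ∩ {p | p 6 ^ 2 + p 7 ^ 2 = 1}
  have hK : IsCompact K := (hK₀.inter_right (isClosed_le continuous_const cs6)).inter_right
    (isClosed_eq (by fun_prop) continuous_const)
  have cg : Continuous g := by fun_prop
  have cg' : Continuous g' := by fun_prop
  have e1 : ∀ p, Y₁ p = 0 → p 4 = 0 := by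
    intro p h
    have h : -2 * k₂ * p 4 ^ 2 = 0 := h
    have : p 4 ^ 2 = 0 := by
      rcases mul_eq_zero.1 h with h | h
      · linarith
      · exact h
    exact pow_eq_zero_iff (two_ne_zero) |>.1 this
  have f2 : ∀ p, p 4 = 0 → Y₂ p = -(k₁ * (p 2 * p 5) ^ 2) := by
    intro p h
    simp only [Y₂, h]
    ring
  have e2 : ∀ p, Y₁ p = 0 → Y₂ p = 0 → p 4 = 0 ∧ p 2 * p 5 = 0 := by
    intro p h1 h2
    have h4 := e1 p h1
    rw [f2 p h4] at h2
    refine ⟨h4, ?_⟩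
    have : (p 2 * p 5) ^ 2 = 0 := by
      rcases mul_eq_zero.1 (neg_eq_zero.1 h2) with h | h
      · linarith
      · exact h
    exact pow_eq_zero_iff (two_ne_zero) |>.1 this
  have f3 : ∀ p, p 4 = 0 → p 2 * p 5 = 0 → Y₃ p = -((p 2 * g p) ^ 2) := by
    intro p h1 h2
    simp only [Y₃, h1]
    linear_combination (p 2 * (k₄ * g p) - p 2 * g' p) * h2
  have e3 : ∀ p, Y₁ p = 0 → Y₂ p = 0 → Y₃ p = 0 → p 4 = 0 ∧ p 2 * p 5 = 0 ∧ p 2 * g p = 0 := by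
    intro p h1 h2 h3
    obtain ⟨h4, h5⟩ := e2 p h1 h2
    rw [f3 p h4 h5] at h3
    exact ⟨h4, h5, pow_eq_zero_iff (two_ne_zero) |>.1 (neg_eq_zero.1 h3)⟩
  have f4 : ∀ p, p 4 = 0 → p 2 * p 5 = 0 → p 2 * g p = 0 →
      Y₄ p = -((p 2 * f (p 2) * p 6) ^ 2) := by
    intro p h1 h2 h3
    simp only [Y₄, g', h1]
    linear_combination (-k₃ * p 2 * f (p 2) * p 6) * h2 + (p 2 * f (p 2) * p 7) * h3
  have e4 : ∀ p, Y₁ p = 0 → Y₂ p = 0 → Y₃ p = 0 → Y₄ p = 0 →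
      p 4 = 0 ∧ p 2 * f (p 2) * p 6 = 0 := by
    intro p h1 h2 h3 h4
    obtain ⟨h5, h6, h7⟩ := e3 p h1 h2 h3
    rw [f4 p h5 h6 h7] at h4
    exact ⟨h5, pow_eq_zero_iff (two_ne_zero) |>.1 (neg_eq_zero.1 h4)⟩
  have f5 : ∀ p, p 4 = 0 → p 2 * f (p 2) * p 6 = 0 → Y₅ p = -((p 2 * f (p 2) * p 7) ^ 2) := by
    intro p h1 h2
    simp only [Y₅, h1]
    linear_combination (p 2 * f (p 2) * p 6) * h2
  have e5 : ∀ p ∈ K, Y₁ p = 0 → Y₂ p = 0 → Y₃ p = 0 → Y₄ p = 0 → Y₅ p = 0 →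
      p 4 = 0 ∧ p 2 = 0 ∧ f (p 2) = 0 := by
    intro p hp h1 h2 h3 h4 h5
    obtain ⟨h6, h7⟩ := e4 p h1 h2 h3 h4
    rw [f5 p h6 h7] at h5
    have h8 := pow_eq_zero_iff (two_ne_zero) |>.1 (neg_eq_zero.1 h5)
    have h9 : p 6 ^ 2 + p 7 ^ 2 = 1 := hp.2
    have h10 : p 2 * f (p 2) = 0 := by
      linear_combination (-(p 2 * f (p 2))) * h9 + p 6 * h7 + p 7 * h8
    have h11 : p 2 = 0 := by
      rcases mul_eq_zero.1 h10 with h | h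
      · exact h
      · exact (hf0 _).1 h
    exact ⟨h6, h11, (hf0 _).2 h11⟩
  have f6 : ∀ p, f (p 2) = 0 → Y₆ p = -(k₄ * (k₃ * p 3 ^ 2 + p 5 ^ 2)) := by
    intro p h
    simp only [Y₆, h]
    ring
  obtain ⟨N₁, N₂, N₃, N₄, N₅, N₆, hN⟩ := matrosov K hK Y₁ Y₂ Y₃ Y₄ Y₅ Y₆ Y₇
    (by fun_prop) (by fun_prop) (by fun_prop) (by fun_prop) (by fun_prop) (by fun_prop)
    (by fun_prop)
    (by
      intro p hp
      have : 0 ≤ k₂ * p 4 ^ 2 := by positivity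
      simp only [Y₁]
      linarith)
    (by
      intro p hp h1
      rw [f2 p (e1 p h1)]
      have : 0 ≤ (k₁ * (p 2 * p 5) ^ 2) := by positivity
      linarith)
    (by
      intro p hp h1 h2
      obtain ⟨h3, h4⟩ := e2 p h1 h2
      rw [f3 p h3 h4]
      linarith [sq_nonneg (p 2 * g p)])
    (by
      intro p hp h1 h2 h3
      obtain ⟨h4, h5, h6⟩ := e3 p h1 h2 h3
      rw [f4 p h4 h5 h6]
      linarith [sq_nonneg (p 2 * f (p 2) * p 6)])
    (by
      intro p hp h1 h2 h3 h4
      obtain ⟨h5, h6⟩ := e4 p h1 h2 h3 h4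
      rw [f5 p h5 h6]
      linarith [sq_nonneg (p 2 * f (p 2) * p 7)])
    (by
      intro p hp h1 h2 h3 h4 h5
      obtain ⟨h6, h7, h8⟩ := e5 p hp h1 h2 h3 h4 h5
      rw [f6 p h8]
      have : 0 ≤ (k₄ * (k₃ * p 3 ^ 2 + p 5 ^ 2)) := by positivity
      linarith)
    (by
      intro p hp h1 h2 h3 h4 h5 h6
      obtain ⟨q4, q2, qf⟩ := e5 p hp h1 h2 h3 h4 h5
      rw [f6 p qf] at h6
      have h7 : k₃ * p 3 ^ 2 + p 5 ^ 2 = 0 := by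
        rcases mul_eq_zero.1 (neg_eq_zero.1 h6) with h | h
        · linarith
        · exact h
      have h8 : 0 ≤ k₃ * p 3 ^ 2 := by positivity
      have h9 := sq_nonneg (p 5)
      have q5 : p 5 = 0 := pow_eq_zero_iff (two_ne_zero) |>.1 (by linarith)
      have q3 : p 3 = 0 := by
        have : k₃ * p 3 ^ 2 = 0 := by linarith
        rcases mul_eq_zero.1 this with h | h
        · linarith
        · exact pow_eq_zero_iff (two_ne_zero) |>.1 h
      have hs : ε ≤ s6 p := hp.1.2
      simp only [s6, S6, q2, q3, q4, q5] at hs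
      simp only [Y₇, q2, q3, q4, q5]
      have hpos : 0 < p 0 ^ 2 + p 1 ^ 2 := by nlinarith
      have hm : 0 < min (2 * d ^ 3 / c) (2 * d) := by positivity
      have i1 := mul_le_mul_of_nonneg_right (min_le_left (2 * d ^ 3 / c) (2 * d)) (sq_nonneg (p 0))
      have i2 := mul_le_mul_of_nonneg_right (min_le_right (2 * d ^ 3 / c) (2 * d)) (sq_nonneg (p 1))
      have i3 := mul_pos hm hpos
      simp only [mul_zero, zero_div]
      linarith)
  let Y : (Fin 8 → ℝ) → ℝ := fun p => N₁ * Y₁ p + (N₂ * Y₂ p + (N₃ * Y₃ p + (N₄ * Y₄ p +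
      (N₅ * Y₅ p + (N₆ * Y₆ p + Y₇ p)))))
  let A : (Fin 8 → ℝ) → ℝ := fun p => N₁ * A₁ p + (N₂ * A₂ p + (N₃ * A₃ p + (N₄ * A₄ p +
      (N₅ * A₅ p + (N₆ * A₆ p + A₇ p)))))
  have cY : Continuous Y := by fun_prop
  have cA : Continuous A := by fun_prop
  obtain ⟨δ, hδ, hYδ⟩ : ∃ δ, 0 < δ ∧ ∀ p ∈ K, Y p ≤ -δ := by
    rcases K.eq_empty_or_nonempty with he | hne
    · exact ⟨1, one_pos, by simp [he]⟩
    · obtain ⟨q, hq, hqm⟩ := hK.exists_isMaxOn hne cY.continuousOn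
      refine ⟨-Y q, by linarith [hN q hq], fun p hp => ?_⟩
      have : Y p ≤ Y q := hqm hp
      linarith
  obtain ⟨C, hC⟩ := hK₀.exists_bound_of_continuousOn cA.continuousOn
  refine ⟨(2 * |C| + 1) / δ, by positivity, ?_⟩
  intro t₀ xb vb z ψ u r hsol hM
  by_contra hcon
  push Not at hcon
  let P : ℝ → (Fin 8 → ℝ) := fun t => ![xb t, vb t, z t, ψ t, u t, r t, Real.sin t, Real.cos t]
  have hPK₀ : ∀ t, t₀ ≤ t → P t ∈ K₀ := by
    intro t ht
    have hm := hM t ht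
    unfold S6 at hm
    have hb : 0 ≤ max M 1 + 1 := by positivity
    have key : ∀ y : ℝ, y ^ 2 ≤ max M 1 → ‖y‖ ≤ max M 1 + 1 := by
      intro y hy
      rw [Real.norm_eq_abs]
      apply abs_le_of_sq_le_sq _ hb
      nlinarith [le_max_right M 1]
    have hx0 := sq_nonneg (xb t)
    have hv0 := sq_nonneg (vb t)
    have hz0 := sq_nonneg (z t)
    have hψ0 := sq_nonneg (ψ t)
    have hu0 := sq_nonneg (u t)
    have hr0 := sq_nonneg (r t)
    have hmm := le_max_left M 1
    have hm1 := le_max_right M 1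
    have hsc := Real.sin_sq_le_one t
    have hcc := Real.cos_sq_le_one t
    rw [mem_closedBall_zero_iff, pi_norm_le_iff_of_nonneg hb]
    intro i
    fin_cases i
    · exact key (xb t) (by linarith)
    · exact key (vb t) (by linarith)
    · exact key (z t) (by linarith)
    · exact key (ψ t) (by linarith)
    · exact key (u t) (by linarith)
    · exact key (r t) (by linarith)
    · exact key (Real.sin t) (by linarith)
    · exact key (Real.cos t) (by linarith)
  have hder : ∀ t, t₀ ≤ t → HasDerivAt (fun t => A (P t)) (Y (P t)) t := by
    intro t ht
    obtain ⟨hx, hv, hz, hψ, hu, hr⟩ := hsol t ht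
    have hσ := Real.hasDerivAt_sin t
    have hκ := Real.hasDerivAt_cos t
    have hfz : HasDerivAt (fun t => f (z t)) (f' (z t) * (-(u t * r t))) t :=
      (hff (z t)).comp t hz
    have hg : HasDerivAt (fun t => -k₃ * ψ t + f (z t) * Real.cos t)
        (-k₃ * r t + (f' (z t) * (-(u t * r t)) * Real.cos t + f (z t) * (-Real.sin t))) t :=
      (hψ.const_mul (-k₃)).add (hfz.mul hκ)
    have d1 : HasDerivAt (fun t => A₁ (P t)) (Y₁ (P t)) t := by
      refine HasDerivAt.congr_deriv (((hz.fun_pow 2).const_mul k₁).add (hu.fun_pow 2)) ?_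
      show _ = -2 * k₂ * u t ^ 2
      push_cast
      ring
    have d2 : HasDerivAt (fun t => A₂ (P t)) (Y₂ (P t)) t := by
      refine HasDerivAt.congr_deriv ((hu.fun_mul hz).fun_mul hr).fun_neg ?_
      show _ = -((k₁ * z t * r t - k₂ * u t) * z t * r t + u t * (-(u t * r t)) * r t
        + u t * z t * ((-k₃ * ψ t + f (z t) * Real.cos t) - k₄ * r t))
      ring
    have d3 : HasDerivAt (fun t => A₃ (P t)) (Y₃ (P t)) t := by
      refine HasDerivAt.congr_deriv (((hz.fun_pow 2).fun_mul hr).fun_mul hg).fun_neg ?_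
      show _ = -(2 * z t * (-(u t * r t)) * r t * (-k₃ * ψ t + f (z t) * Real.cos t)
        + z t ^ 2 * ((-k₃ * ψ t + f (z t) * Real.cos t) - k₄ * r t)
          * (-k₃ * ψ t + f (z t) * Real.cos t)
        + z t ^ 2 * r t * (-k₃ * r t +
          (f' (z t) * (-(u t * r t)) * Real.cos t + f (z t) * (-Real.sin t))))
      push_cast
      ring
    have d4 : HasDerivAt (fun t => A₄ (P t)) (Y₄ (P t)) t := by
      refine HasDerivAt.congr_deriv ((((hz.fun_pow 2).fun_mul hg).fun_mul hfz).fun_mul hσ) ?_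
      show _ = 2 * z t * (-(u t * r t)) * (-k₃ * ψ t + f (z t) * Real.cos t) * f (z t) * Real.sin t
        + z t ^ 2 * (-k₃ * r t +
          (f' (z t) * (-(u t * r t)) * Real.cos t + f (z t) * (-Real.sin t))) * f (z t) * Real.sin t
        + z t ^ 2 * (-k₃ * ψ t + f (z t) * Real.cos t) * (f' (z t) * (-(u t * r t))) * Real.sin t
        + z t ^ 2 * (-k₃ * ψ t + f (z t) * Real.cos t) * f (z t) * Real.cos t
      have hP6 : P t 6 = Real.sin t := rfl
      push_cast
      try rw [hP6]
      ring
    have d5 : HasDerivAt (fun t => A₅ (P t)) (Y₅ (P t)) t := by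
      refine HasDerivAt.congr_deriv
        ((((hz.fun_pow 2).fun_mul (hfz.fun_pow 2)).fun_mul hσ).fun_mul hκ).fun_neg ?_
      show _ = -(2 * z t * (-(u t * r t)) * f (z t) ^ 2 * Real.sin t * Real.cos t
        + z t ^ 2 * (2 * f (z t) * (f' (z t) * (-(u t * r t)))) * Real.sin t * Real.cos t
        + z t ^ 2 * f (z t) ^ 2 * (Real.cos t ^ 2 - Real.sin t ^ 2))
      push_cast
      ring
    have d6 : HasDerivAt (fun t => A₆ (P t)) (Y₆ (P t)) t :=
      P_deriv k₃ k₄ ψ r t _ hψ hr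
    have d7 : HasDerivAt (fun t => A₇ (P t)) (Y₇ (P t)) t :=
      W_deriv a b c d hc hd xb vb t (z t) (ψ t) (u t) (r t) hx hv
    exact (d1.const_mul N₁).add ((d2.const_mul N₂).add ((d3.const_mul N₃).add
      ((d4.const_mul N₄).add ((d5.const_mul N₅).add ((d6.const_mul N₆).add d7)))))
  have hfin := decrease (fun t => A (P t)) (fun t => Y (P t)) t₀ ((2 * |C| + 1) / δ) δ |C| hδ
    (by positivity) hder
    (fun t h1 h2 => hYδ (P t) ⟨⟨hPK₀ t h1, (hcon t h1 h2).le⟩, Real.sin_sq_add_cos_sq t⟩)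
    (fun t h1 => (hC (P t) (hPK₀ t h1)).trans (le_abs_self C))
  rw [mul_div_cancel₀ _ hδ.ne'] at hfin
  linarith


/-- The full closed-loop stabilization system in the state (x̄, v̄, z, ψ, ū, r) under the
proposed control law is globally uniformly asymptotically stable. -/
theorem stmt2 (a b c d k₁ k₂ k₃ k₄ : ℝ) (hc : 0 < c) (hd : 0 < d)
    (hk₁ : 0 < k₁) (hk₂ : 0 < k₂) (hk₃ : 0 < k₃) (hk₄ : 0 < k₄)
    (f : ℝ → ℝ) (hf : ContDiff ℝ (⊤ : ℕ∞) f) (hf0 : ∀ z : ℝ, f z = 0 ↔ z = 0) :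
    ∃ χ : ℝ → ℝ → ℝ, IsClassKL χ ∧
      ∀ t₀ : ℝ, ∀ xb vb z ψ u r : ℝ → ℝ,
        (∀ t, t₀ ≤ t →
          HasDerivAt xb ((u t - d * xb t) / c + (z t - vb t) * r t / d) t ∧
          HasDerivAt vb (-(u t - d * xb t) * r t - d * (vb t - a * r t - b * ψ t)) t ∧
          HasDerivAt z (-(u t * r t)) t ∧
          HasDerivAt ψ (r t) t ∧
          HasDerivAt u (k₁ * z t * r t - k₂ * u t) t ∧
          HasDerivAt r (-k₃ * ψ t - k₄ * r t + f (z t) * Real.cos t) t) →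
        ∀ t, t₀ ≤ t →
          norm6 (xb t) (vb t) (z t) (ψ t) (u t) (r t) ≤
            χ (norm6 (xb t₀) (vb t₀) (z t₀) (ψ t₀) (u t₀) (r t₀)) (t - t₀) := by
  have cf : Continuous f := hf.continuous
  have cf' : Continuous (deriv f) := hf.continuous_deriv (by simp)
  have hff : ∀ y, HasDerivAt f (deriv f y) y := fun y =>
    (hf.differentiable (by simp) y).hasDerivAt
  obtain ⟨G, cG, hG0, hG⟩ := S_bound a b c d k₁ k₂ k₃ k₄ hc hd hk₁ hk₂ hk₃ hk₄ f
  -- boundedness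
  have UB : ∀ s, 0 ≤ s → ∃ M, ∀ t₀ xb vb z ψ u r, Sol a b c d k₁ k₂ k₃ k₄ f t₀ xb vb z ψ u r →
        S6 (xb t₀) (vb t₀) (z t₀) (ψ t₀) (u t₀) (r t₀) ≤ s →
        ∀ t, t₀ ≤ t → S6 (xb t) (vb t) (z t) (ψ t) (u t) (r t) ≤ M := by
    intro s hs
    have hq : 0 ≤ (k₁ + 1) * s / k₁ := by positivity
    obtain ⟨C, hC⟩ := (isCompact_closedBall (0:ℝ) (Real.sqrt ((k₁ + 1) * s / k₁))
      ).exists_bound_of_continuousOn cf.continuousOn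
    refine ⟨G (s, C ^ 2), hG s (C ^ 2) hs (sq_nonneg C) fun y hy => ?_⟩
    have h1 : ‖f y‖ ≤ C := hC y (by
      rw [mem_closedBall_zero_iff, Real.norm_eq_abs]
      exact Real.abs_le_sqrt hy)
    have h2 := norm_nonneg (f y)
    rw [← sq_abs, ← Real.norm_eq_abs]
    gcongr
  -- stability
  have US : ∀ ε, 0 < ε → ∃ δ, 0 < δ ∧ ∀ t₀ xb vb z ψ u r,
        Sol a b c d k₁ k₂ k₃ k₄ f t₀ xb vb z ψ u r →
        S6 (xb t₀) (vb t₀) (z t₀) (ψ t₀) (u t₀) (r t₀) ≤ δ →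
        ∀ t, t₀ ≤ t → S6 (xb t) (vb t) (z t) (ψ t) (u t) (r t) ≤ ε := by
    intro ε hε
    obtain ⟨η, hη, h1⟩ := Metric.continuousAt_iff.1 (cG.continuousAt (x := (0, 0))) ε hε
    have hcf2 : ContinuousAt (fun y => f y ^ 2) 0 := (cf.pow 2).continuousAt
    obtain ⟨ρ, hρ, h2⟩ := Metric.continuousAt_iff.1 hcf2 (η / 2) (by linarith)
    have hf00 : f 0 = 0 := (hf0 0).2 rfl
    refine ⟨min (η / 2) (k₁ / (k₁ + 1) * (ρ / 2) ^ 2), by positivity, ?_⟩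
    set δ := min (η / 2) (k₁ / (k₁ + 1) * (ρ / 2) ^ 2) with hδ
    have hδ0 : 0 < δ := by rw [hδ]; positivity
    have hδ1 : δ ≤ η / 2 := min_le_left _ _
    have hδ2 : δ ≤ k₁ / (k₁ + 1) * (ρ / 2) ^ 2 := min_le_right _ _
    have hδ3 : (k₁ + 1) * δ / k₁ ≤ (ρ / 2) ^ 2 := by
      calc (k₁ + 1) * δ / k₁ ≤ (k₁ + 1) * (k₁ / (k₁ + 1) * (ρ / 2) ^ 2) / k₁ := by gcongr
        _ = (ρ / 2) ^ 2 := by field_simp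
    intro t₀ xb vb z ψ u r hsol h0 t ht
    have h3 := hG δ (η / 2) hδ0.le (by linarith) (by
      intro y hy
      have h4 : |y| ≤ ρ / 2 := abs_le_of_sq_le_sq (hy.trans hδ3) (by linarith)
      have h5 := h2 (x := y) (by rw [Real.dist_eq, sub_zero]; linarith)
      rw [Real.dist_eq, hf00] at h5
      have := (abs_lt.1 h5).2
      linarith) t₀ xb vb z ψ u r hsol h0 t ht
    have h6 := h1 (x := (δ, η / 2)) (by
      rw [Prod.dist_eq, max_lt_iff]
      simp only [Real.dist_eq, sub_zero]
      rw [abs_of_pos hδ0, abs_of_pos (by linarith)]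
      constructor <;> linarith)
    rw [hG0, Real.dist_eq, sub_zero] at h6
    have := (abs_lt.1 h6).2
    linarith
  have hnn : ∀ x v z ψ u r : ℝ, 0 ≤ S6 x v z ψ u r := by
    intro x v z ψ u r
    unfold S6
    positivity
  have hsq : ∀ x v z ψ u r R : ℝ, norm6 x v z ψ u r ≤ R → S6 x v z ψ u r ≤ R ^ 2 := by
    intro x v z ψ u r R h
    have h0 : norm6 x v z ψ u r = Real.sqrt (S6 x v z ψ u r) := rfl
    rw [h0] at h
    exact (Real.sqrt_le_left ((Real.sqrt_nonneg _).trans h)).1 h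
  have hsq' : ∀ x v z ψ u r M : ℝ, S6 x v z ψ u r ≤ M → norm6 x v z ψ u r ≤ Real.sqrt M :=
    fun x v z ψ u r M h => Real.sqrt_le_sqrt h
  obtain ⟨χ, hχ, h⟩ := kl_lemma (fun t₀ N => ∃ xb vb z ψ u r : ℝ → ℝ,
      Sol a b c d k₁ k₂ k₃ k₄ f t₀ xb vb z ψ u r ∧
      N = fun t => norm6 (xb t) (vb t) (z t) (ψ t) (u t) (r t))
    (by
      intro R
      obtain ⟨M, hM⟩ := UB (R ^ 2) (sq_nonneg R)
      refine ⟨Real.sqrt M, ?_⟩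
      rintro t₀ N ⟨xb, vb, z, ψ, u, r, hsol, rfl⟩ h0 t ht
      exact hsq' _ _ _ _ _ _ _ (hM t₀ xb vb z ψ u r hsol (hsq _ _ _ _ _ _ _ h0) t ht))
    (by
      intro ε hε
      obtain ⟨δ, hδ, h⟩ := US (ε ^ 2) (by positivity)
      refine ⟨Real.sqrt δ, Real.sqrt_pos.2 hδ, ?_⟩
      rintro t₀ N ⟨xb, vb, z, ψ, u, r, hsol, rfl⟩ h0 t ht
      have h1 := hsq _ _ _ _ _ _ _ h0
      rw [Real.sq_sqrt hδ.le] at h1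
      have h2 := hsq' _ _ _ _ _ _ _ (h t₀ xb vb z ψ u r hsol h1 t ht)
      rwa [Real.sqrt_sq hε.le] at h2)
    (by
      intro R ε hε
      obtain ⟨δ, hδ, h⟩ := US (ε ^ 2) (by positivity)
      obtain ⟨M, hM⟩ := UB (R ^ 2) (sq_nonneg R)
      obtain ⟨τ, hτ, hhit⟩ := hit a b c d k₁ k₂ k₃ k₄ hc hd hk₁ hk₂ hk₃ hk₄ f (deriv f)
        cf cf' hff hf0 M δ hδ
      refine ⟨τ, hτ, ?_⟩
      rintro t₀ N ⟨xb, vb, z, ψ, u, r, hsol, rfl⟩ h0 t ht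
      obtain ⟨t₁, h1, h2, h3⟩ := hhit t₀ xb vb z ψ u r hsol
        (hM t₀ xb vb z ψ u r hsol (hsq _ _ _ _ _ _ _ h0))
      have h4 := hsq' _ _ _ _ _ _ _ (h t₁ xb vb z ψ u r
        (fun s hs => hsol s (h1.trans hs)) h3 t (h2.trans ht))
      rwa [Real.sqrt_sq hε.le] at h4)
  refine ⟨χ, hχ, ?_⟩
  intro t₀ xb vb z ψ u r hsol t ht
  exact h t₀ (fun t => norm6 (xb t) (vb t) (z t) (ψ t) (u t) (r t))
    ⟨xb, vb, z, ψ, u, r, hsol, rfl⟩ (Real.sqrt_nonneg _) t ht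
end

section
/- Let c, d > 0 and k₁, k₂, k₃, k₄ > 0. Let u_d : [0,∞) → ℝ be twice differentiable and r_d : [0,∞) → ℝ differentiable, with u_d, u̇_d, ü_d, r_d, ṙ_d bounded on [0,∞), and assume it is NOT the case that |u_d(t)| + |r_d(t)| → 0 as t → ∞. Then the linear time-varying system in the state (z_e, ψ_e, r_e, ū_e) given by ż_e = (c u̇_d + d u_d) ψ_e − ū_e r_d, ψ̇_e = r_e, ū̇_e = k₁ z_e r_d − k₃ ū_e, together with d/dt(r_e − r_ed) = −ψ_e − k₄ (r_e − r_ed) where r_ed(t) = −k₁ z_e(t)(c u̇_d(t) + d u_d(t)) − k₂ ψ_e(t), is globally uniformly asymptotically stable: there exists a class-κℓ function χ such that every solution on [0,∞) satisfies ‖(z_e(t), ψ_e(t), r_e(t), ū_e(t))‖ ≤ χ(‖(z_e(0), ψ_e(0), r_e(0), ū_e(0))‖, t) for all t ≥ 0. -/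
open Real Filter

/-- Boundedness on the nonnegative half-line. -/
def BddPos (f : ℝ → ℝ) : Prop := ∃ C : ℝ, ∀ t : ℝ, 0 ≤ t → |f t| ≤ C

theorem BddPos.add {f g : ℝ → ℝ} (hf : BddPos f) (hg : BddPos g) :
    BddPos (fun t => f t + g t) := by
  obtain ⟨C, hC⟩ := hf
  obtain ⟨D, hD⟩ := hg
  exact ⟨C + D, fun t ht => (abs_add_le _ _).trans (add_le_add (hC t ht) (hD t ht))⟩

theorem BddPos.mul {f g : ℝ → ℝ} (hf : BddPos f) (hg : BddPos g) :
    BddPos (fun t => f t * g t) := by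
  obtain ⟨C, hC⟩ := hf
  obtain ⟨D, hD⟩ := hg
  refine ⟨C * D, fun t ht => ?_⟩
  rw [abs_mul]
  exact mul_le_mul (hC t ht) (hD t ht) (abs_nonneg _) ((abs_nonneg _).trans (hC t ht))

theorem BddPos.const (k : ℝ) : BddPos (fun _ => k) := ⟨|k|, fun _ _ => le_rfl⟩

theorem BddPos.neg {f : ℝ → ℝ} (hf : BddPos f) : BddPos (fun t => - f t) := by
  obtain ⟨C, hC⟩ := hf
  exact ⟨C, fun t ht => by rw [abs_neg]; exact hC t ht⟩

theorem BddPos.sub {f g : ℝ → ℝ} (hf : BddPos f) (hg : BddPos g) :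
    BddPos (fun t => f t - g t) := by
  simpa only [sub_eq_add_neg] using hf.add hg.neg

/-- Barbalat-type lemma. -/
theorem barbalat {f g g' : ℝ → ℝ} {l : ℝ} (hf : ∀ t : ℝ, 0 ≤ t → HasDerivAt f (g t) t)
    (hg : ∀ t : ℝ, 0 ≤ t → HasDerivAt g (g' t) t) (hb : BddPos g')
    (hlim : Tendsto f atTop (nhds l)) : Tendsto g atTop (nhds 0) := by
  obtain ⟨L, hL⟩ := hb
  have hL0 : 0 ≤ L := (abs_nonneg _).trans (hL 0 le_rfl)
  rw [Metric.tendsto_atTop]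
  intro ε hε
  set h : ℝ := ε / (2 * (L + 1)) with hh
  have hpos : 0 < h := by positivity
  have hLh : L * h < ε / 2 := by
    have : (L + 1) * h = ε / 2 := by rw [hh]; field_simp
    nlinarith
  obtain ⟨T, hT⟩ := (Metric.tendsto_atTop.1 hlim) (ε / 4 * h) (by positivity)
  refine ⟨max T 0, fun t ht => ?_⟩
  have htT : T ≤ t := (le_max_left _ _).trans ht
  have ht0 : 0 ≤ t := (le_max_right _ _).trans ht
  obtain ⟨ξ, hξ, hξe⟩ := exists_hasDerivAt_eq_slope f g (show t < t + h by linarith)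
    (fun s hs => (hf s (ht0.trans hs.1)).continuousAt.continuousWithinAt)
    (fun s hs => hf s (ht0.trans hs.1.le))
  obtain ⟨η, hη, hηe⟩ := exists_hasDerivAt_eq_slope g g' hξ.1
    (fun s hs => (hg s (ht0.trans hs.1)).continuousAt.continuousWithinAt)
    (fun s hs => hg s (ht0.trans hs.1.le))
  have h1 := hT t htT
  have h2 := hT (t + h) (by linarith)
  rw [Real.dist_eq, abs_lt] at h1 h2
  have e1 : g ξ * h = f (t + h) - f t := by
    rw [hξe, add_sub_cancel_left, div_mul_cancel₀ _ hpos.ne']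
  have hd : 0 < ξ - t := by linarith [hξ.1]
  have e2 : g' η * (ξ - t) = g ξ - g t := by
    rw [hηe]; field_simp
  have h3 := abs_le.1 (hL η (ht0.trans hη.1.le))
  have hξ2 : ξ - t < h := by linarith [hξ.2]
  have h4 : g ξ < ε / 2 := by
    by_contra hcon
    push Not at hcon
    nlinarith
  have h5 : -(ε / 2) < g ξ := by
    by_contra hcon
    push Not at hcon
    nlinarith
  have h6 : g' η * (ξ - t) ≤ L * h := by nlinarith
  have h7 : -(L * h) ≤ g' η * (ξ - t) := by nlinarith
  rw [Real.dist_eq, sub_zero, abs_lt]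
  constructor <;> linarith

theorem filter_upper {c d : ℝ} (hc : 0 < c) (hd : 0 < d) {f f' : ℝ → ℝ}
    (hf : ∀ t : ℝ, 0 ≤ t → HasDerivAt f (f' t) t)
    (hlim : Tendsto (fun t => c * f' t + d * f t) atTop (nhds 0)) {ε : ℝ} (hε : 0 < ε) :
    ∀ᶠ t in atTop, f t < ε := by
  have hev : ∀ᶠ t in atTop, c * f' t + d * f t < d * (ε / 2) :=
    hlim.eventually (gt_mem_nhds (by positivity))
  obtain ⟨T, hT⟩ := eventually_atTop.1 (hev.and (eventually_ge_atTop 0))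
  have hT0 : 0 ≤ T := (hT T le_rfl).2
  have hder : ∀ t : ℝ, T ≤ t → HasDerivAt (fun s => Real.exp (d / c * s) * (f s - ε / 2))
      (Real.exp (d / c * t) * (d / c * 1) * (f t - ε / 2) + Real.exp (d / c * t) * f' t) t := by
    intro t ht
    exact (((hasDerivAt_id t).const_mul (d / c)).exp).mul ((hf t (hT0.trans ht)).sub_const _)
  have hanti : AntitoneOn (fun s => Real.exp (d / c * s) * (f s - ε / 2)) (Set.Ici T) := by
    refine antitoneOn_of_deriv_nonpos (convex_Ici T)
      (fun t ht => (hder t ht).continuousAt.continuousWithinAt) ?_ ?_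
    · intro t ht
      rw [interior_Ici] at ht
      exact (hder t (le_of_lt ht)).differentiableAt.differentiableWithinAt
    · intro t ht
      rw [interior_Ici] at ht
      rw [(hder t (le_of_lt ht)).deriv]
      have h1 := (hT t (le_of_lt ht)).1
      have : Real.exp (d / c * t) * (d / c * 1) * (f t - ε / 2) + Real.exp (d / c * t) * f' t
          = Real.exp (d / c * t) / c * (c * f' t + d * f t - d * (ε / 2)) := by
        field_simp; ring
      rw [this]
      exact mul_nonpos_of_nonneg_of_nonpos (by positivity) (by linarith)
  set K := Real.exp (d / c * T) * (f T - ε / 2) with hK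
  have hexp : Tendsto (fun t : ℝ => Real.exp (d / c * t)) atTop atTop :=
    Real.tendsto_exp_atTop.comp (tendsto_id.const_mul_atTop (by positivity))
  filter_upwards [eventually_ge_atTop T, hexp.eventually (eventually_gt_atTop (K / (ε / 2)))]
    with t ht h2
  have h3 : Real.exp (d / c * t) * (f t - ε / 2) ≤ K := hanti (Set.mem_Ici.2 le_rfl) ht ht
  rw [div_lt_iff₀ (by positivity)] at h2
  have h4 : Real.exp (d / c * t) * (f t - ε / 2) < Real.exp (d / c * t) * (ε / 2) := by linarith
  have := lt_of_mul_lt_mul_left h4 (Real.exp_pos _).le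
  linarith

theorem filter_zero {c d : ℝ} (hc : 0 < c) (hd : 0 < d) {f f' : ℝ → ℝ}
    (hf : ∀ t : ℝ, 0 ≤ t → HasDerivAt f (f' t) t)
    (hlim : Tendsto (fun t => c * f' t + d * f t) atTop (nhds 0)) :
    Tendsto f atTop (nhds 0) := by
  rw [Metric.tendsto_nhds]
  intro ε hε
  have hneg : Tendsto (fun t => c * (- f' t) + d * (- f t)) atTop (nhds 0) := by
    have := hlim.neg
    rw [neg_zero] at this
    exact this.congr (fun t => by ring)
  filter_upwards [filter_upper hc hd hf hlim hε,
    filter_upper hc hd (f := fun t => - f t) (f' := fun t => - f' t)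
      (fun t ht => (hf t ht).neg) hneg hε] with t h1 h2
  rw [Real.dist_eq, sub_zero, abs_lt]
  constructor <;> linarith

theorem core (k₁ k₂ k₃ k₄ : ℝ)
    (hk₁ : 0 < k₁) (hk₂ : 0 < k₂) (hk₃ : 0 < k₃) (hk₄ : 0 < k₄)
    (a a' r r' z p e u : ℝ → ℝ)
    (ha : ∀ t : ℝ, 0 ≤ t → HasDerivAt a (a' t) t)
    (hr : ∀ t : ℝ, 0 ≤ t → HasDerivAt r (r' t) t)
    (ba : BddPos a) (ba' : BddPos a') (br : BddPos r) (br' : BddPos r')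
    (hz : ∀ t : ℝ, 0 ≤ t → HasDerivAt z (a t * p t - u t * r t) t)
    (hp : ∀ t : ℝ, 0 ≤ t → HasDerivAt p (e t - k₁ * (a t * z t) - k₂ * p t) t)
    (he : ∀ t : ℝ, 0 ≤ t → HasDerivAt e (- p t - k₄ * e t) t)
    (hu : ∀ t : ℝ, 0 ≤ t → HasDerivAt u (k₁ * (z t * r t) - k₃ * u t) t) :
    AntitoneOn (fun t => k₁ * (z t * z t) + p t * p t + e t * e t + u t * u t) (Set.Ici 0) ∧
    (¬ (Tendsto a atTop (nhds 0) ∧ Tendsto r atTop (nhds 0)) →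
      Tendsto (fun t => k₁ * (z t * z t) + p t * p t + e t * e t + u t * u t) atTop
        (nhds 0)) := by
  set V : ℝ → ℝ := fun t => k₁ * (z t * z t) + p t * p t + e t * e t + u t * u t with hV
  have hVd : ∀ t : ℝ, 0 ≤ t →
      HasDerivAt V (-2 * (k₂ * (p t * p t) + k₄ * (e t * e t) + k₃ * (u t * u t))) t := by
    intro t ht
    have := (((((hz t ht).mul (hz t ht)).const_mul k₁).add ((hp t ht).mul (hp t ht))).add
      ((he t ht).mul (he t ht))).add ((hu t ht).mul (hu t ht))
    refine this.congr_deriv ?_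
    ring
  have hV0 : ∀ t, 0 ≤ V t := by
    intro t
    have h1 := mul_self_nonneg (z t)
    have h2 := mul_self_nonneg (p t)
    have h3 := mul_self_nonneg (e t)
    have h4 := mul_self_nonneg (u t)
    simp only [hV]
    positivity
  have hanti : AntitoneOn V (Set.Ici 0) := by
    refine antitoneOn_of_deriv_nonpos (convex_Ici 0)
      (fun t ht => (hVd t ht).continuousAt.continuousWithinAt) ?_ ?_
    · intro t ht
      rw [interior_Ici] at ht
      exact (hVd t (le_of_lt ht)).differentiableAt.differentiableWithinAt
    · intro t ht
      rw [interior_Ici] at ht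
      rw [(hVd t (le_of_lt ht)).deriv]
      have h2 := mul_self_nonneg (p t)
      have h3 := mul_self_nonneg (e t)
      have h4 := mul_self_nonneg (u t)
      have : 0 ≤ k₂ * (p t * p t) + k₄ * (e t * e t) + k₃ * (u t * u t) := by positivity
      linarith
  refine ⟨hanti, fun hPE => ?_⟩
  have hVle : ∀ t : ℝ, 0 ≤ t → V t ≤ V 0 := fun t ht => hanti (Set.mem_Ici.2 le_rfl) ht ht
  have sqb : ∀ x C : ℝ, x * x ≤ C → |x| ≤ C + 1 := by
    intro x C h
    rw [abs_le]
    constructor <;> nlinarith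
  have bz : BddPos z := by
    refine ⟨V 0 / k₁ + 1, fun t ht => sqb _ _ ?_⟩
    rw [le_div_iff₀ hk₁]
    have := hVle t ht
    simp only [hV] at this ⊢
    nlinarith [mul_self_nonneg (p t), mul_self_nonneg (e t), mul_self_nonneg (u t)]
  have hkz : ∀ t, 0 ≤ k₁ * (z t * z t) := fun t => mul_nonneg hk₁.le (mul_self_nonneg _)
  have bp : BddPos p := by
    refine ⟨V 0 + 1, fun t ht => sqb _ _ ?_⟩
    refine le_trans ?_ (hVle t ht)
    simp only [hV]
    nlinarith [hkz t, mul_self_nonneg (e t), mul_self_nonneg (u t)]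
  have be : BddPos e := by
    refine ⟨V 0 + 1, fun t ht => sqb _ _ ?_⟩
    refine le_trans ?_ (hVle t ht)
    simp only [hV]
    nlinarith [hkz t, mul_self_nonneg (p t), mul_self_nonneg (u t)]
  have bu : BddPos u := by
    refine ⟨V 0 + 1, fun t ht => sqb _ _ ?_⟩
    refine le_trans ?_ (hVle t ht)
    simp only [hV]
    nlinarith [hkz t, mul_self_nonneg (p t), mul_self_nonneg (e t)]
  have bz' := (ba.mul bp).sub (bu.mul br)
  have bp' := (be.sub ((BddPos.const k₁).mul (ba.mul bz))).sub ((BddPos.const k₂).mul bp)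
  have be' := bp.neg.sub ((BddPos.const k₄).mul be)
  have bu' := ((BddPos.const k₁).mul (bz.mul br)).sub ((BddPos.const k₃).mul bu)
  -- the limit of V
  have hmono : Antitone (fun t => V (max t 0)) := by
    intro s t hst
    exact hanti (Set.mem_Ici.2 (le_max_right _ _)) (Set.mem_Ici.2 (le_max_right _ _))
      (max_le_max hst le_rfl)
  obtain ⟨l, hl⟩ : ∃ l, Tendsto V atTop (nhds l) := by
    refine ⟨_, (tendsto_atTop_ciInf hmono ⟨0, ?_⟩).congr' ?_⟩
    · rintro _ ⟨t, rfl⟩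
      exact hV0 _
    · filter_upwards [eventually_ge_atTop 0] with t ht
      rw [max_eq_left ht]
  have hW : Tendsto (fun t => -2 * (k₂ * (p t * p t) + k₄ * (e t * e t) + k₃ * (u t * u t)))
      atTop (nhds 0) := by
    refine barbalat hVd (fun t ht => (((((hp t ht).mul (hp t ht)).const_mul k₂).add
      (((he t ht).mul (he t ht)).const_mul k₄)).add
      (((hu t ht).mul (hu t ht)).const_mul k₃)).const_mul (-2)) ?_ hl
    exact (BddPos.const (-2)).mul ((((BddPos.const k₂).mul ((bp'.mul bp).add (bp.mul bp'))).add
      ((BddPos.const k₄).mul ((be'.mul be).add (be.mul be')))).add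
      ((BddPos.const k₃).mul ((bu'.mul bu).add (bu.mul bu'))))
  have sqlim : ∀ (k : ℝ) (f : ℝ → ℝ), 0 < k → (∀ t, k * (f t * f t) ≤
      k₂ * (p t * p t) + k₄ * (e t * e t) + k₃ * (u t * u t)) →
      Tendsto (fun t => f t * f t) atTop (nhds 0) := by
    intro k f hk hle
    have h1 : Tendsto (fun t => (-1 / (2 * k)) *
      (-2 * (k₂ * (p t * p t) + k₄ * (e t * e t) + k₃ * (u t * u t)))) atTop (nhds 0) := by
      simpa using hW.const_mul (-1 / (2 * k))
    refine squeeze_zero (fun t => mul_self_nonneg _) (fun t => ?_) h1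
    have h2 := hle t
    have : (-1 / (2 * k)) *
      (-2 * (k₂ * (p t * p t) + k₄ * (e t * e t) + k₃ * (u t * u t))) =
      (k₂ * (p t * p t) + k₄ * (e t * e t) + k₃ * (u t * u t)) / k := by field_simp
    rw [this, le_div_iff₀ hk]
    linarith
  have n2 : ∀ t, 0 ≤ k₂ * (p t * p t) := fun t => mul_nonneg hk₂.le (mul_self_nonneg _)
  have n4 : ∀ t, 0 ≤ k₄ * (e t * e t) := fun t => mul_nonneg hk₄.le (mul_self_nonneg _)
  have n3 : ∀ t, 0 ≤ k₃ * (u t * u t) := fun t => mul_nonneg hk₃.le (mul_self_nonneg _)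
  have lpp := sqlim k₂ p hk₂ (fun t => by linarith [n2 t, n3 t, n4 t])
  have lee := sqlim k₄ e hk₄ (fun t => by linarith [n2 t, n3 t, n4 t])
  have luu := sqlim k₃ u hk₃ (fun t => by linarith [n2 t, n3 t, n4 t])
  have unsq : ∀ f : ℝ → ℝ, Tendsto (fun t => f t * f t) atTop (nhds 0) →
      Tendsto f atTop (nhds 0) := by
    intro f hf
    have := (Real.continuous_sqrt.tendsto 0).comp hf
    rw [Real.sqrt_zero] at this
    refine (tendsto_zero_iff_abs_tendsto_zero _).2 (this.congr (fun t => ?_))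
    simp [Real.sqrt_mul_self_eq_abs]
  have lp := unsq _ lpp
  have le' := unsq _ lee
  have lu := unsq _ luu
  have lp' := barbalat hp (fun t ht => ((he t ht).sub
    (((ha t ht).mul (hz t ht)).const_mul k₁)).sub ((hp t ht).const_mul k₂))
    ((be'.sub ((BddPos.const k₁).mul ((ba'.mul bz).add (ba.mul bz')))).sub
      ((BddPos.const k₂).mul bp')) lp
  have lu' := barbalat hu (fun t ht => (((hz t ht).mul (hr t ht)).const_mul k₁).sub
    ((hu t ht).const_mul k₃))
    (((BddPos.const k₁).mul ((bz'.mul br).add (bz.mul br'))).sub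
      ((BddPos.const k₃).mul bu')) lu
  have laz : Tendsto (fun t => a t * z t) atTop (nhds 0) := by
    have := ((le'.sub (lp.const_mul k₂)).sub lp').const_mul (1 / k₁)
    simp only [mul_zero, sub_zero] at this
    refine this.congr (fun t => ?_)
    field_simp
    ring
  have lzr : Tendsto (fun t => r t * z t) atTop (nhds 0) := by
    have := (lu'.add (lu.const_mul k₃)).const_mul (1 / k₁)
    simp only [mul_zero, add_zero] at this
    refine this.congr (fun t => ?_)
    field_simp
    ring
  have lzz : Tendsto (fun t => z t * z t) atTop (nhds (1 / k₁ * l)) := by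
    have := (((hl.sub lpp).sub lee).sub luu).const_mul (1 / k₁)
    simp only [sub_zero] at this
    refine this.congr (fun t => ?_)
    simp only [hV]
    field_simp
    ring
  by_cases hl0 : l = 0
  · rw [hl0] at hl
    exact hl
  · exfalso
    have hne : 1 / k₁ * l ≠ 0 := mul_ne_zero (by positivity) hl0
    have key : ∀ f : ℝ → ℝ, Tendsto (fun t => f t * z t) atTop (nhds 0) →
        Tendsto f atTop (nhds 0) := by
      intro f hf
      apply unsq
      have h1 := (hf.mul hf).div lzz hne
      simp only [mul_zero, zero_div] at h1
      refine h1.congr' ?_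
      filter_upwards [lzz.eventually_ne hne] with t ht
      have hz0 : z t ≠ 0 := fun h => ht (by rw [h]; ring)
      simp only [Pi.div_apply]
      field_simp
    exact hPE ⟨key a laz, key r lzr⟩

/-- Uniformity over a linear space of trajectories. -/
theorem uniform_bound {E : Type} [NormedAddCommGroup E] [NormedSpace ℝ E]
    [FiniteDimensional ℝ E] (S : Submodule ℝ (ℝ → E))
    (h0 : ∀ x ∈ S, x 0 = 0 → ∀ t : ℝ, 0 ≤ t → x t = 0)
    (hS : ∀ x ∈ S, ∃ g : ℝ → ℝ, AntitoneOn g (Set.Ici 0) ∧ Tendsto g atTop (nhds 0) ∧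
      ∀ t : ℝ, 0 ≤ t → ‖x t‖ ≤ g t) :
    ∃ G : ℝ → ℝ, AntitoneOn G (Set.Ici 0) ∧ Tendsto G atTop (nhds 0) ∧
      ∀ x ∈ S, ∀ t : ℝ, 0 ≤ t → ‖x t‖ ≤ G t * ‖x 0‖ := by
  classical
  let ev : (ℝ → E) →ₗ[ℝ] E := LinearMap.proj 0
  let W : Submodule ℝ E := S.map ev
  let b := Module.finBasis ℝ W
  have hex : ∀ i, ∃ x ∈ S, x 0 = (b i : E) := by
    intro i
    obtain ⟨x, hx, hxe⟩ := (b i).2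
    exact ⟨x, hx, hxe⟩
  choose X hXS hX0 using hex
  choose g hga hgt hgb using fun i => hS (X i) (hXS i)
  let φ : W →L[ℝ] (Fin (Module.finrank ℝ W) → ℝ) :=
    LinearMap.toContinuousLinearMap (b.equivFun : W →ₗ[ℝ] _)
  have hg0 : ∀ i t, 0 ≤ t → 0 ≤ g i t := fun i t ht => (norm_nonneg _).trans (hgb i t ht)
  refine ⟨fun t => ‖φ‖ * ∑ i, g i t, ?_, ?_, ?_⟩
  · intro s hs t ht hst
    exact mul_le_mul_of_nonneg_left (Finset.sum_le_sum fun i _ => hga i hs ht hst)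
      (norm_nonneg φ)
  · have := (tendsto_finsetSum Finset.univ (fun i _ => hgt i)).const_mul ‖φ‖
    simpa using this
  · intro x hx t ht
    let w : W := ⟨x 0, ⟨x, hx, rfl⟩⟩
    have hw : ∑ i, φ w i • b i = w := b.sum_equivFun w
    have hw' : ∑ i, φ w i • (b i : E) = x 0 := by
      have := congrArg (Subtype.val) hw
      simpa using this
    have hy : x - ∑ i, φ w i • X i ∈ S :=
      S.sub_mem hx (S.sum_mem fun i _ => S.smul_mem _ (hXS i))
    have hyt := h0 _ hy (by
      simp only [Pi.sub_apply, Finset.sum_apply, Pi.smul_apply, hX0, hw', sub_self]) t ht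
    simp only [Pi.sub_apply, Finset.sum_apply, Pi.smul_apply, sub_eq_zero] at hyt
    rw [hyt]
    have hφ : ∀ i, |φ w i| ≤ ‖φ‖ * ‖x 0‖ := by
      intro i
      have h1 := norm_le_pi_norm (φ w) i
      have h2 := φ.le_opNorm w
      exact h1.trans h2
    calc ‖∑ i, φ w i • X i t‖ ≤ ∑ i, ‖φ w i • X i t‖ := norm_sum_le _ _
      _ ≤ ∑ i, (‖φ‖ * ‖x 0‖) * g i t := by
          refine Finset.sum_le_sum fun i _ => ?_
          rw [norm_smul, Real.norm_eq_abs]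
          exact mul_le_mul (hφ i) (hgb i t ht) (norm_nonneg _) (by positivity)
      _ = ‖φ‖ * (∑ i, g i t) * ‖x 0‖ := by rw [← Finset.mul_sum]; ring

/-- The space of solutions. -/
def solSpace (k₁ k₂ k₃ k₄ : ℝ) (a r : ℝ → ℝ) : Submodule ℝ (ℝ → (Fin 4 → ℝ)) where
  carrier := {x | ∀ t : ℝ, 0 ≤ t →
    HasDerivAt (fun s => x s 0) (a t * x t 1 - x t 3 * r t) t ∧
    HasDerivAt (fun s => x s 1) (x t 2) t ∧
    HasDerivAt (fun s => x s 3) (k₁ * x t 0 * r t - k₃ * x t 3) t ∧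
    HasDerivAt (fun s => x s 2 - (-(k₁ * x s 0 * a s) - k₂ * x s 1))
      (- x t 1 - k₄ * (x t 2 - (-(k₁ * x t 0 * a t) - k₂ * x t 1))) t}
  add_mem' := by
    intro x y hx hy t ht
    obtain ⟨x1, x2, x3, x4⟩ := hx t ht
    obtain ⟨y1, y2, y3, y4⟩ := hy t ht
    refine ⟨(x1.add y1).congr_deriv ?_, (x2.add y2).congr_deriv ?_,
      (x3.add y3).congr_deriv ?_, ((x4.add y4).congr_deriv ?_).congr_of_eventuallyEq
        (Eventually.of_forall fun s => ?_)⟩ <;> simp only [Pi.add_apply] <;> ring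
  zero_mem' := by
    intro t ht
    refine ⟨?_, ?_, ?_, ?_⟩ <;> simpa using hasDerivAt_const t (0 : ℝ)
  smul_mem' := by
    intro m x hx t ht
    obtain ⟨x1, x2, x3, x4⟩ := hx t ht
    refine ⟨(x1.const_mul m).congr_deriv ?_, (x2.const_mul m).congr_deriv ?_,
      (x3.const_mul m).congr_deriv ?_, ((x4.const_mul m).congr_deriv ?_).congr_of_eventuallyEq
        (Eventually.of_forall fun s => ?_)⟩ <;>
      simp only [Pi.smul_apply, smul_eq_mul] <;> ring

theorem abs_le_norm4 (x : Fin 4 → ℝ) : ‖x‖ ≤ norm4 (x 0) (x 1) (x 2) (x 3) := by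
  unfold norm4
  rw [pi_norm_le_iff_of_nonneg (Real.sqrt_nonneg _)]
  intro i
  rw [Real.norm_eq_abs]
  apply Real.abs_le_sqrt
  fin_cases i <;> simp <;>
    nlinarith [sq_nonneg (x 0), sq_nonneg (x 1), sq_nonneg (x 2), sq_nonneg (x 3)]

theorem norm4_le (x : Fin 4 → ℝ) : norm4 (x 0) (x 1) (x 2) (x 3) ≤ 2 * ‖x‖ := by
  unfold norm4
  apply Real.sqrt_le_iff.2
  refine ⟨by positivity, ?_⟩
  have h : ∀ i, x i ^ 2 ≤ ‖x‖ ^ 2 := by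
    intro i
    have := norm_le_pi_norm x i
    rw [Real.norm_eq_abs] at this
    rw [← sq_abs]
    gcongr
  nlinarith [h 0, h 1, h 2, h 3]

/-- The linearization at the origin of the closed-loop tracking error subsystem is globally
uniformly asymptotically stable under the persistent excitation condition. -/
theorem stmt18 (c d k₁ k₂ k₃ k₄ : ℝ) (hc : 0 < c) (hd : 0 < d)
    (hk₁ : 0 < k₁) (hk₂ : 0 < k₂) (hk₃ : 0 < k₃) (hk₄ : 0 < k₄)
    (ud ud' ud'' rd rd' : ℝ → ℝ)
    (hud : ∀ t : ℝ, 0 ≤ t → HasDerivAt ud (ud' t) t)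
    (hud' : ∀ t : ℝ, 0 ≤ t → HasDerivAt ud' (ud'' t) t)
    (hrd : ∀ t : ℝ, 0 ≤ t → HasDerivAt rd (rd' t) t)
    (hbdd : ∃ M : ℝ, ∀ t : ℝ, 0 ≤ t →
      |ud t| ≤ M ∧ |ud' t| ≤ M ∧ |ud'' t| ≤ M ∧ |rd t| ≤ M ∧ |rd' t| ≤ M)
    (hPE : ¬ Tendsto (fun t => |ud t| + |rd t|) atTop (nhds 0)) :
    ∃ χ : ℝ → ℝ → ℝ, IsClassKL χ ∧
      ∀ ze ψe re ue : ℝ → ℝ,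
        (∀ t : ℝ, 0 ≤ t →
          HasDerivAt ze ((c * ud' t + d * ud t) * ψe t - ue t * rd t) t ∧
          HasDerivAt ψe (re t) t ∧
          HasDerivAt ue (k₁ * ze t * rd t - k₃ * ue t) t ∧
          HasDerivAt
            (fun s => re s - (-(k₁ * ze s * (c * ud' s + d * ud s)) - k₂ * ψe s))
            (-ψe t -
              k₄ * (re t - (-(k₁ * ze t * (c * ud' t + d * ud t)) - k₂ * ψe t))) t) →
        ∀ t : ℝ, 0 ≤ t →
          norm4 (ze t) (ψe t) (re t) (ue t) ≤
            χ (norm4 (ze 0) (ψe 0) (re 0) (ue 0)) t := by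
  obtain ⟨M, hM⟩ := hbdd
  have bud : BddPos ud := ⟨M, fun t ht => (hM t ht).1⟩
  have bud' : BddPos ud' := ⟨M, fun t ht => (hM t ht).2.1⟩
  have bud'' : BddPos ud'' := ⟨M, fun t ht => (hM t ht).2.2.1⟩
  have brd : BddPos rd := ⟨M, fun t ht => (hM t ht).2.2.2.1⟩
  have brd' : BddPos rd' := ⟨M, fun t ht => (hM t ht).2.2.2.2⟩
  set a : ℝ → ℝ := fun t => c * ud' t + d * ud t with ha
  have had : ∀ t : ℝ, 0 ≤ t → HasDerivAt a (c * ud'' t + d * ud' t) t :=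
    fun t ht => ((hud' t ht).const_mul c).add ((hud t ht).const_mul d)
  have ba : BddPos a := ((BddPos.const c).mul bud').add ((BddPos.const d).mul bud)
  have ba' : BddPos (fun t => c * ud'' t + d * ud' t) :=
    ((BddPos.const c).mul bud'').add ((BddPos.const d).mul bud')
  have hne : ¬ (Tendsto a atTop (nhds 0) ∧ Tendsto rd atTop (nhds 0)) := by
    rintro ⟨h1, h2⟩
    apply hPE
    have h3 := filter_zero hc hd hud h1
    simpa using h3.abs.add h2.abs
  obtain ⟨A, hA⟩ := id ba
  have hA0 : 0 ≤ A := (abs_nonneg _).trans (hA 0 le_rfl)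
  -- bound on each solution
  have hcore : ∀ x ∈ solSpace k₁ k₂ k₃ k₄ a rd, ∃ V : ℝ → ℝ, AntitoneOn V (Set.Ici 0) ∧
      Tendsto V atTop (nhds 0) ∧ (∀ t, 0 ≤ V t) ∧ (x 0 = 0 → V 0 = 0) ∧
      ∀ t : ℝ, 0 ≤ t → ‖x t‖ ≤ (1 / k₁ + 1 + (1 + k₁ * A * (1 / k₁ + 1) + k₂)) * √(V t) := by
    intro x hx
    have hc := core k₁ k₂ k₃ k₄ hk₁ hk₂ hk₃ hk₄ a _ rd rd' (fun t => x t 0) (fun t => x t 1)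
      (fun s => x s 2 - (-(k₁ * x s 0 * a s) - k₂ * x s 1)) (fun t => x t 3)
      had hrd ba ba' brd brd' (fun t ht => (hx t ht).1)
      (fun t ht => (hx t ht).2.1.congr_deriv (by ring))
      (fun t ht => (hx t ht).2.2.2)
      (fun t ht => (hx t ht).2.2.1.congr_deriv (by ring))
    refine ⟨_, hc.1, hc.2 hne, ?_, ?_, ?_⟩
    · intro t
      have h1 := mul_self_nonneg (x t 0)
      have h2 := mul_self_nonneg (x t 1)
      have h3 := mul_self_nonneg (x t 2 - (-(k₁ * x t 0 * a t) - k₂ * x t 1))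
      have h4 := mul_self_nonneg (x t 3)
      have h5 := mul_nonneg hk₁.le h1
      linarith
    · intro h
      simp [h]
    · intro t ht
      have h1 := mul_self_nonneg (x t 0)
      have h2 := mul_self_nonneg (x t 1)
      have h3 := mul_self_nonneg (x t 2 - (-(k₁ * x t 0 * a t) - k₂ * x t 1))
      have h4 := mul_self_nonneg (x t 3)
      have h5 := mul_nonneg hk₁.le h1
      set e := x t 2 - (-(k₁ * x t 0 * a t) - k₂ * x t 1) with he
      set V := k₁ * (x t 0 * x t 0) + x t 1 * x t 1 + e * e + x t 3 * x t 3 with hV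
      have hV0 : 0 ≤ V := by linarith
      set q := √V with hq
      have hq0 : 0 ≤ q := Real.sqrt_nonneg _
      have hqq : q * q = V := Real.mul_self_sqrt hV0
      have b1 : |x t 1| ≤ q := Real.abs_le_sqrt (by nlinarith)
      have b3 : |x t 3| ≤ q := Real.abs_le_sqrt (by nlinarith)
      have be : |e| ≤ q := Real.abs_le_sqrt (by nlinarith)
      have b0 : |x t 0| ≤ (1 / k₁ + 1) * q := by
        refine abs_le_of_sq_le_sq (b := (1 / k₁ + 1) * q) ?_ (by positivity)
        have e1 : x t 0 * x t 0 ≤ 1 / k₁ * V := by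
          rw [one_div, ← div_eq_inv_mul, le_div_iff₀ hk₁]
          linarith
        have e2 : 1 / k₁ ≤ (1 / k₁ + 1) ^ 2 := by
          have : 0 < 1 / k₁ := by positivity
          nlinarith
        calc x t 0 ^ 2 = x t 0 * x t 0 := by ring
          _ ≤ 1 / k₁ * V := e1
          _ ≤ (1 / k₁ + 1) ^ 2 * V := mul_le_mul_of_nonneg_right e2 hV0
          _ = ((1 / k₁ + 1) * q) ^ 2 := by rw [← hqq]; ring
      have b2 : |x t 2| ≤ (1 + k₁ * A * (1 / k₁ + 1) + k₂) * q := by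
        have e1 : x t 2 = e + -(k₁ * (a t * x t 0)) + -(k₂ * x t 1) := by rw [he]; ring
        rw [e1]
        have e2 : |a t * x t 0| ≤ A * ((1 / k₁ + 1) * q) := by
          rw [abs_mul]
          exact mul_le_mul (hA t ht) b0 (abs_nonneg _) hA0
        calc |e + -(k₁ * (a t * x t 0)) + -(k₂ * x t 1)|
            ≤ |e| + |-(k₁ * (a t * x t 0))| + |-(k₂ * x t 1)| := abs_add_three _ _ _
          _ = |e| + k₁ * |a t * x t 0| + k₂ * |x t 1| := by
              rw [abs_neg, abs_neg, abs_mul k₁, abs_mul k₂, abs_of_pos hk₁, abs_of_pos hk₂]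
          _ ≤ q + k₁ * (A * ((1 / k₁ + 1) * q)) + k₂ * q := by gcongr
          _ = _ := by ring
      have p1 : 0 ≤ (1 / k₁ + 1) * q := by positivity
      have p1' : 0 ≤ 1 / k₁ * q := by positivity
      have p2 : 0 ≤ (1 + k₁ * A * (1 / k₁ + 1) + k₂) * q := by positivity
      have p3 : 0 ≤ (k₁ * A * (1 / k₁ + 1) + k₂) * q := by positivity
      rw [pi_norm_le_iff_of_nonneg (by positivity)]
      intro i
      rw [Real.norm_eq_abs]
      fin_cases i
      · show |x t 0| ≤ _
        linarith
      · show |x t 1| ≤ _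
        linarith
      · show |x t 2| ≤ _
        linarith
      · show |x t 3| ≤ _
        linarith
  have hK : 0 ≤ 1 / k₁ + 1 + (1 + k₁ * A * (1 / k₁ + 1) + k₂) := by positivity
  obtain ⟨G, hGa, hGt, hGb⟩ := uniform_bound (solSpace k₁ k₂ k₃ k₄ a rd)
    (by
      intro x hx hx0 t ht
      obtain ⟨V, hVa, -, hV0, hVz, hVb⟩ := hcore x hx
      have h1 : V t ≤ V 0 := hVa (Set.mem_Ici.2 le_rfl) ht ht
      rw [hVz hx0] at h1
      have h2 := hVb t ht
      rw [le_antisymm h1 (hV0 t), Real.sqrt_zero, mul_zero] at h2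
      exact norm_le_zero_iff.1 h2)
    (by
      intro x hx
      obtain ⟨V, hVa, hVt, hV0, hVz, hVb⟩ := hcore x hx
      refine ⟨_, ?_, ?_, hVb⟩
      · intro s hs t ht hst
        exact mul_le_mul_of_nonneg_left (Real.sqrt_le_sqrt (hVa hs ht hst)) hK
      · have := ((Real.continuous_sqrt.tendsto 0).comp hVt).const_mul
          (1 / k₁ + 1 + (1 + k₁ * A * (1 / k₁ + 1) + k₂))
        simpa using this)
  have hGpos : ∀ s : ℝ, 0 ≤ s → 0 ≤ G s := by
    intro s hs
    by_contra hneg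
    push Not at hneg
    have : (0 : ℝ) ≤ G s := by
      refine le_of_tendsto hGt ?_
      filter_upwards [eventually_ge_atTop s] with t ht
      exact hGa hs (hs.trans ht) ht
    linarith
  refine ⟨fun r s => 2 * (G s + Real.exp (-s)) * r, ⟨?_, ?_, ?_⟩, ?_⟩
  · intro s hs
    have hp : 0 < 2 * (G s + Real.exp (-s)) := by
      have := hGpos s hs
      positivity
    refine ⟨by fun_prop, ?_, by simp⟩
    intro x _ y _ hxy
    exact mul_lt_mul_of_pos_left hxy hp
  · intro r hr s hs t ht hst
    have h1 : G t ≤ G s := hGa hs ht hst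
    have h2 : Real.exp (-t) ≤ Real.exp (-s) := Real.exp_le_exp.2 (by linarith)
    exact mul_le_mul_of_nonneg_right (by linarith) hr
  · intro r hr
    have := ((hGt.add (Real.tendsto_exp_neg_atTop_nhds_zero)).const_mul 2).mul_const r
    simpa using this
  · intro ze ψe re ue hsol t ht
    let x : ℝ → Fin 4 → ℝ := fun s => ![ze s, ψe s, re s, ue s]
    have hx : x ∈ solSpace k₁ k₂ k₃ k₄ a rd := fun s hs => hsol s hs
    have h1 := hGb x hx t ht
    have h2 : norm4 (ze t) (ψe t) (re t) (ue t) ≤ 2 * ‖x t‖ := norm4_le (x t)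
    have h3 : ‖x 0‖ ≤ norm4 (ze 0) (ψe 0) (re 0) (ue 0) := abs_le_norm4 (x 0)
    have h4 := hGpos t ht
    have h5 := Real.exp_pos (-t)
    have h6 : 0 ≤ ‖x 0‖ := norm_nonneg _
    calc norm4 (ze t) (ψe t) (re t) (ue t) ≤ 2 * (G t * ‖x 0‖) := by linarith
      _ ≤ 2 * ((G t + Real.exp (-t)) * norm4 (ze 0) (ψe 0) (re 0) (ue 0)) := by
          gcongr
          linarith
      _ = _ := by ring
end
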